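/- arXiv:1806.06022 — 3 statements merged into one kernel-verified Lean document; each statement's English description precedes it below -/
import Mathlib

section
/- For every positive integer r and every real α > 0 there is a constant C = C(α, r) such that the following holds. If G is a finite group of exponent r and A ⊆ G is a symmetric set with |A| ≥ α|G|, then there is a normal subgroup H of G with [G : H] ≤ C such that H ⊆ A⁴. -/
open Pointwise

theorem aux_rigid {G E κ : Type} [Group G] [NormedAddCommGroup E] [InnerProductSpace ℝ E]
    [Fintype κ] (r : ℕ) (hr : 0 < r) (hG : ∀ x : G, x ^ r = 1)
    (ρ : G → E →ₗ[ℝ] E) (h1 : ∀ v, ρ 1 v = v) (hm : ∀ g h v, ρ (g * h) v = ρ g (ρ h v))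
    (hn : ∀ g v, ‖ρ g v‖ = ‖v‖) (b : OrthonormalBasis κ ℝ E) (S : Finset κ)
    (hS : ∀ g, ∀ i ∈ S, ∀ j, j ∉ S → inner ℝ (b j) (ρ g (b i)) = 0)
    (g : G) (δ : ℝ) (hδ : ∀ i ∈ S, ‖ρ g (b i) - b i‖ ≤ δ) (hδ' : (r : ℝ) * (S.card * δ) < 1) :
    ∀ i ∈ S, ρ g (b i) = b i := by
  intro i hi
  by_contra hne
  set w := ρ g (b i) - b i with hw
  have hw0 : 0 < ‖w‖ := norm_pos_iff.2 (sub_ne_zero.2 hne)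
  -- w in the span
  have hwS : w = ∑ j ∈ S, inner ℝ (b j) w • b j := by
    conv_lhs => rw [← b.sum_repr' w]
    symm
    apply Finset.sum_subset (Finset.subset_univ _)
    intro j _ hj
    have : inner ℝ (b j) (b i) = 0 := b.orthonormal.2 (by rintro rfl; exact hj hi)
    rw [hw, inner_sub_right, hS g i hi j hj, this]; simp
  have hstep : ‖ρ g w - w‖ ≤ S.card * δ * ‖w‖ := by
    have : ρ g w - w = ∑ j ∈ S, inner ℝ (b j) w • (ρ g (b j) - b j) := by
      simp only [smul_sub, Finset.sum_sub_distrib]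
      rw [← hwS]
      congr 1
      conv_lhs => rw [hwS]
      simp
    rw [this]
    refine (norm_sum_le _ _).trans ?_
    have : ∀ j ∈ S, ‖inner ℝ (b j) w • (ρ g (b j) - b j)‖ ≤ ‖w‖ * δ := by
      intro j hj
      rw [norm_smul]
      gcongr
      · have := norm_inner_le_norm (𝕜 := ℝ) (b j) w
        simpa using this
      · exact hδ j hj
    refine (Finset.sum_le_sum this).trans ?_
    simp; apply le_of_eq; ring
  have hpow : ∀ k : ℕ, ‖ρ (g ^ k) w - w‖ ≤ k * ‖ρ g w - w‖ := by
    intro k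
    induction k with
    | zero => simp [h1]
    | succ k ih =>
      have : ρ (g ^ (k+1)) w - w = ρ (g ^ k) (ρ g w - w) + (ρ (g ^ k) w - w) := by
        rw [pow_succ, hm, map_sub (ρ (g ^ k))]; abel
      rw [this]
      refine (norm_add_le _ _).trans ?_
      rw [hn]; push_cast; linarith
  have hsum : ∑ k ∈ Finset.range r, ρ (g ^ k) w = 0 := by
    have : ∀ k ∈ Finset.range r, ρ (g ^ k) w = ρ (g ^ (k+1)) (b i) - ρ (g ^ k) (b i) := by
      intro k _
      rw [hw, map_sub, pow_succ, hm]
    rw [Finset.sum_congr rfl this, Finset.sum_range_sub (fun k => ρ (g ^ k) (b i)), hG]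
    simp
  have hle : (r : ℝ) * ‖w‖ ≤ r * (r * ‖ρ g w - w‖) := by
    have e : (r : ℝ) • w = - ∑ k ∈ Finset.range r, (ρ (g ^ k) w - w) := by
      rw [Finset.sum_sub_distrib, hsum]; simp [Nat.cast_smul_eq_nsmul]
    have : ‖(r : ℝ) • w‖ ≤ r * (r * ‖ρ g w - w‖) := by
      rw [e, norm_neg]
      refine (norm_sum_le _ _).trans ?_
      have : ∀ k ∈ Finset.range r, ‖ρ (g ^ k) w - w‖ ≤ r * ‖ρ g w - w‖ := by
        intro k hk
        refine (hpow k).trans ?_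
        gcongr
        exact (Finset.mem_range.1 hk).le
      refine (Finset.sum_le_sum this).trans ?_
      simp
    rwa [norm_smul, Real.norm_natCast] at this
  have hr' : (0:ℝ) < r := by exact_mod_cast hr
  have h2 := le_of_mul_le_mul_left hle hr'
  have h3 : (r:ℝ) * ‖ρ g w - w‖ ≤ r * (S.card * δ * ‖w‖) := by gcongr
  nlinarith

theorem aux_index {G E κ : Type} [Group G] [NormedAddCommGroup E] [InnerProductSpace ℝ E]
    [Fintype κ] (r : ℕ) (hr : 0 < r) (hG : ∀ x : G, x ^ r = 1)
    (ρ : G → E →ₗ[ℝ] E) (h1 : ∀ v, ρ 1 v = v) (hm : ∀ g h v, ρ (g * h) v = ρ g (ρ h v))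
    (hn : ∀ g v, ‖ρ g v‖ = ‖v‖) (b : OrthonormalBasis κ ℝ E) (S : Finset κ)
    (hS : ∀ g, ∀ i ∈ S, ∀ j, j ∉ S → inner ℝ (b j) (ρ g (b i)) = 0) :
    ∃ H : Subgroup G, (∀ g ∈ H, ∀ i ∈ S, ρ g (b i) = b i) ∧ H.Normal ∧
      H.index ≤ (2 * (r * S.card ^ 2 + 1) + 1) ^ (S.card * S.card) := by
  classical
  have hinv : ∀ g v, ρ g⁻¹ (ρ g v) = v := fun g v => by rw [← hm, inv_mul_cancel, h1]
  have hexp : ∀ g, ∀ i ∈ S, ρ g (b i) = ∑ j ∈ S, inner ℝ (b j) (ρ g (b i)) • b j := by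
    intro g i hi
    conv_lhs => rw [← b.sum_repr' (ρ g (b i))]
    symm
    apply Finset.sum_subset (Finset.subset_univ _)
    intro j _ hj
    rw [hS g i hi j hj]; simp
  let H : Subgroup G :=
    { carrier := {g | ∀ i ∈ S, ρ g (b i) = b i}
      one_mem' := fun i _ => h1 _
      mul_mem' := by
        intro x y hx hy i hi
        rw [hm, hy i hi, hx i hi]
      inv_mem' := by
        intro x hx i hi
        conv_lhs => rw [← hx i hi]
        exact hinv _ _ }
  have hH : ∀ g, g ∈ H ↔ ∀ i ∈ S, ρ g (b i) = b i := fun g => Iff.rfl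
  refine ⟨H, fun g hg => (hH g).1 hg, ⟨?_⟩, ?_⟩
  · intro h hh g
    rw [hH] at hh ⊢
    intro i hi
    rw [hm, hm]
    have : ρ h (ρ g⁻¹ (b i)) = ρ g⁻¹ (b i) := by
      rw [hexp g⁻¹ i hi, map_sum]
      refine Finset.sum_congr rfl fun j hj => ?_
      rw [map_smul, hh j hj]
    rw [this, ← hm, mul_inv_cancel, h1]
  · set M : ℕ := r * S.card ^ 2 + 1 with hM
    have hM0 : (0:ℝ) < M := by rw [hM]; positivity
    have habs : ∀ g i j, |inner ℝ (b j) (ρ g (b i))| ≤ 1 := by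
      intro g i j
      have := norm_inner_le_norm (𝕜 := ℝ) (b j) (ρ g (b i))
      simpa [hn] using this
    let cell : G → (S × S → Finset.Icc (-(M:ℤ)) M) := fun g p =>
      ⟨⌊(M:ℝ) * inner ℝ (b p.2) (ρ g (b p.1))⌋, by
        have := abs_le.1 (habs g p.1 p.2)
        rw [Finset.mem_Icc]
        constructor
        · rw [Int.le_floor]; push_cast; nlinarith
        · have : (⌊(M:ℝ) * inner ℝ (b p.2) (ρ g (b p.1))⌋ : ℝ) ≤ M :=
            (Int.floor_le _).trans (by nlinarith)
          exact_mod_cast this⟩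
    have hcell : ∀ g h, cell g = cell h → g⁻¹ * h ∈ H := by
      intro g h hgh
      rw [hH]
      refine aux_rigid r hr hG ρ h1 hm hn b S hS _ (S.card * (1 / M)) ?_ ?_
      · intro i hi
        have e : ‖ρ (g⁻¹ * h) (b i) - b i‖ = ‖ρ h (b i) - ρ g (b i)‖ := by
          rw [← hn g⁻¹ (ρ h (b i) - ρ g (b i)), map_sub, hinv, hm]
        rw [e, hexp h i hi, hexp g i hi, ← Finset.sum_sub_distrib]
        refine (norm_sum_le _ _).trans ?_
        rw [← nsmul_eq_mul]
        refine Finset.sum_le_card_nsmul _ _ _ ?_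
        intro j hj
        rw [← sub_smul, norm_smul, b.norm_eq_one, mul_one, Real.norm_eq_abs]
        have h2 := congrArg Subtype.val (congrFun hgh (⟨i, hi⟩, ⟨j, hj⟩))
        have h3 := Int.abs_sub_lt_one_of_floor_eq_floor h2.symm
        simp only at h3
        rw [← mul_sub, abs_mul, abs_of_pos hM0] at h3
        rw [le_div_iff₀ hM0, mul_comm]
        exact h3.le
      · have : (r:ℝ) * (S.card * (S.card * (1 / M))) = (r * S.card ^ 2) / M := by ring
        rw [this, div_lt_one hM0, hM]
        push_cast; linarith
    have hinj : Function.Injective (fun q : G ⧸ H => cell q.out) := by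
      intro p q hpq
      have := hcell _ _ hpq
      rw [← QuotientGroup.eq] at this
      simpa using this
    have := Nat.card_le_card_of_injective _ hinj
    rw [Subgroup.index]
    refine this.trans (le_of_eq ?_)
    simp only [Nat.card_eq_fintype_card, Fintype.card_fun, Fintype.card_coe, Fintype.card_prod, Int.card_Icc]
    congr 1
    omega

theorem dense_symmetric_bounded_exponent (r : ℕ) (hr : 0 < r) (α : ℝ) (hα : 0 < α) :
    ∃ C : ℕ, ∀ (G : Type) [Group G] [Fintype G] [DecidableEq G],
      (∀ x : G, x ^ r = 1) →
      ∀ A : Finset G, (1 : G) ∈ A → A⁻¹ = A →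
      α * (Fintype.card G : ℝ) ≤ (A.card : ℝ) →
      ∃ H : Subgroup G, H.Normal ∧ H.index ≤ C ∧ (H : Set G) ⊆ ↑(A ^ 4) := by
  obtain ⟨D, hD⟩ := exists_nat_ge (4 / α ^ 3)
  refine ⟨(2 * (r * D ^ 2 + 1) + 1) ^ (D * D), ?_⟩
  intro G _ _ _ hG A hA1 hA hcard
  set n : ℝ := ((Fintype.card G : ℕ) : ℝ) with hn
  have hn0 : 0 < n := by rw [hn]; exact_mod_cast Fintype.card_pos
  have hsym : ∀ x, x⁻¹ ∈ A ↔ x ∈ A := by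
    intro x; rw [← Finset.mem_inv', hA]
  let χ : G → ℝ := fun x => if x ∈ A then 1 else 0
  have hχ : ∀ x, χ x⁻¹ = χ x := fun x => by simp only [χ, hsym]
  have hχ0 : ∀ x, 0 ≤ χ x := fun x => by simp only [χ]; split_ifs <;> norm_num
  have hχ2 : ∀ x, χ x * χ x = χ x := fun x => by simp only [χ]; split_ifs <;> norm_num
  have hχ1 : ∀ x, χ x ≤ 1 := fun x => by simp only [χ]; split_ifs <;> norm_num
  have hχs : ∑ x, χ x = A.card := by simp [χ]
  let T : EuclideanSpace ℝ G →ₗ[ℝ] EuclideanSpace ℝ G :=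
    { toFun := fun f => WithLp.toLp 2 fun x => ∑ y, χ (x⁻¹ * y) * f y
      map_add' := by
        intro f g; ext x; simp [mul_add, Finset.sum_add_distrib]
      map_smul' := by
        intro c f; ext x; simp [Finset.mul_sum, mul_left_comm] }
  have hT : ∀ f x, T f x = ∑ y, χ (x⁻¹ * y) * f y := fun f x => rfl
  let ρ : G → EuclideanSpace ℝ G →ₗ[ℝ] EuclideanSpace ℝ G := fun g =>
    { toFun := fun f => WithLp.toLp 2 fun x => f (g⁻¹ * x)
      map_add' := by intro f g; ext x; simp
      map_smul' := by intro c f; ext x; simp }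
  have hρ : ∀ g f x, ρ g f x = f (g⁻¹ * x) := fun g f x => rfl
  have hinner : ∀ f g : EuclideanSpace ℝ G, inner ℝ f g = ∑ x, f x * g x := by
    intro f g
    rw [PiLp.inner_apply]
    refine Finset.sum_congr rfl fun x _ => ?_
    simp [mul_comm]
  have hTsym : T.IsSymmetric := by
    intro f g
    rw [hinner, hinner]
    simp only [hT, Finset.sum_mul, Finset.mul_sum]
    rw [Finset.sum_comm]
    refine Finset.sum_congr rfl fun x _ => Finset.sum_congr rfl fun y _ => ?_
    rw [← hχ (x⁻¹ * y)]
    simp only [mul_inv_rev, inv_inv]; ring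
  have hρin : ∀ g u v, inner ℝ (ρ g u) (ρ g v) = inner ℝ u v := by
    intro g u v
    rw [hinner, hinner]
    simp only [hρ]
    exact Equiv.sum_comp (Equiv.mulLeft g⁻¹) (fun x => u x * v x)
  have hρn : ∀ g v, ‖ρ g v‖ = ‖v‖ := by
    intro g v
    rw [@norm_eq_sqrt_real_inner (EuclideanSpace ℝ G), @norm_eq_sqrt_real_inner (EuclideanSpace ℝ G), hρin]
  have hcomm : ∀ g f, T (ρ g f) = ρ g (T f) := by
    intro g f
    ext x
    rw [hρ, hT, hT]
    simp only [hρ]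
    rw [← Equiv.sum_comp (Equiv.mulLeft g)]
    refine Finset.sum_congr rfl fun y _ => ?_
    simp [mul_assoc]
  have hfr : Module.finrank ℝ (EuclideanSpace ℝ G) = Fintype.card G := finrank_euclideanSpace
  let b := hTsym.eigenvectorBasis hfr
  let μ := hTsym.eigenvalues hfr
  have hb : ∀ i, T (b i) = μ i • b i := fun i => hTsym.apply_eigenvectorBasis hfr i
  -- Hilbert-Schmidt bound
  have hHS : ∑ i, (μ i) ^ 2 ≤ n ^ 2 := by
    have e1 := LinearMap.trace_eq_sum_inner (T ∘ₗ T) b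
    have e2 := LinearMap.trace_eq_sum_inner (T ∘ₗ T) (EuclideanSpace.basisFun G ℝ)
    have e3 : ∑ i, (μ i) ^ 2 = ∑ i, inner ℝ (b i) ((T ∘ₗ T) (b i)) := by
      refine Finset.sum_congr rfl fun i _ => ?_
      rw [LinearMap.comp_apply, hb, map_smul, hb, inner_smul_right, inner_smul_right,
        real_inner_self_eq_norm_sq, b.norm_eq_one]; ring
    rw [e3, ← e1, e2]
    have : ∀ g ∈ (Finset.univ : Finset G), inner ℝ (EuclideanSpace.basisFun G ℝ g)
        ((T ∘ₗ T) (EuclideanSpace.basisFun G ℝ g)) ≤ n := by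
      intro g _
      rw [LinearMap.comp_apply, ← hTsym, hinner]
      have : ∀ x ∈ (Finset.univ : Finset G), (T (EuclideanSpace.basisFun G ℝ g)) x *
          (T (EuclideanSpace.basisFun G ℝ g)) x ≤ 1 := by
        intro x _
        have : T (EuclideanSpace.basisFun G ℝ g) x = χ (x⁻¹ * g) := by
          rw [hT]; simp
        rw [this, hχ2]; exact hχ1 _
      refine (Finset.sum_le_sum this).trans ?_
      simp [hn]
    refine (Finset.sum_le_sum this).trans ?_
    simp [← hn, sq]
  set S : Finset (Fin (Fintype.card G)) := Finset.univ.filter fun i => α ^ 3 / 4 * n ^ 2 ≤ (μ i) ^ 2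
    with hSdef
  have hScard : S.card ≤ D := by
    have h1 : (S.card : ℝ) * (α ^ 3 / 4 * n ^ 2) ≤ n ^ 2 := by
      rw [← nsmul_eq_mul]
      refine (Finset.card_nsmul_le_sum S (fun i => (μ i) ^ 2) _ ?_).trans ?_
      · intro i hi; exact (Finset.mem_filter.1 hi).2
      · refine (Finset.sum_le_sum_of_subset_of_nonneg (Finset.subset_univ S) ?_).trans hHS
        intros; positivity
    have h2 : (S.card : ℝ) ≤ 4 / α ^ 3 := by
      rw [le_div_iff₀ (by positivity)]
      have hn2 : 0 < n ^ 2 := by positivity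
      by_contra hc
      push Not at hc
      nlinarith
    exact_mod_cast h2.trans hD
  have hS : ∀ g, ∀ i ∈ S, ∀ j, j ∉ S → inner ℝ (b j) (ρ g (b i)) = 0 := by
    intro g i hi j hj
    have e := hTsym (b j) (ρ g (b i))
    rw [hcomm, hb, hb, map_smul, real_inner_smul_left, real_inner_smul_right] at e
    have hne : μ j ≠ μ i := by
      intro h
      apply hj
      rw [hSdef, Finset.mem_filter] at hi ⊢
      rw [h]
      exact ⟨Finset.mem_univ _, hi.2⟩
    by_contra hc
    exact hne (mul_right_cancel₀ hc e)
  obtain ⟨H, hH, hN, hidx⟩ := aux_index r hr hG ρ (by intro v; ext x; rw [hρ]; simp)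
    (by intro g h v; ext x; simp only [hρ]; simp [mul_assoc]) hρn b S hS
  refine ⟨H, hN, hidx.trans ?_, ?_⟩
  · refine (Nat.pow_le_pow_left ?_ _).trans (Nat.pow_le_pow_right (by omega) ?_)
    · gcongr
    · gcongr
  intro h hh
  have hh : h ∈ H := hh
  let a : EuclideanSpace ℝ G := WithLp.toLp 2 χ
  have ha : ∀ x, a x = χ x := fun x => rfl
  set f := T a with hf
  have hf0 : ∀ x, f x ≠ 0 → x ∈ A * A := by
    intro x hx
    rw [hf, hT] at hx
    obtain ⟨y, _, hy⟩ := Finset.exists_ne_zero_of_sum_ne_zero hx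
    have h1 : x⁻¹ * y ∈ A := by
      by_contra hc; apply hy; simp [χ, hc]
    have h2 : y ∈ A := by
      by_contra hc; apply hy; rw [ha]; simp [χ, hc]
    rw [← hsym] at h1
    have := Finset.mul_mem_mul h2 h1
    simpa using this
  suffices hpos : inner ℝ (ρ h f) f ≠ 0 by
    rw [hinner] at hpos
    obtain ⟨x, _, hx⟩ := Finset.exists_ne_zero_of_sum_ne_zero hpos
    have h1 := hf0 _ (left_ne_zero_of_mul hx)
    have h2 := hf0 _ (right_ne_zero_of_mul hx)
    have h3 : (h⁻¹ * x)⁻¹ ∈ A * A := by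
      have := Finset.inv_mem_inv h1
      rwa [mul_inv_rev, hA] at this
    have := Finset.mul_mem_mul h2 h3
    have e : A ^ 4 = A * A * (A * A) := by simp only [pow_succ, pow_zero, one_mul, mul_assoc]
    rw [Finset.mem_coe, e]
    simpa using this
  intro hzero
  -- decomposition
  let f1 : EuclideanSpace ℝ G := ∑ i ∈ S, inner ℝ (b i) f • b i
  let f2 : EuclideanSpace ℝ G := ∑ i ∈ Sᶜ, inner ℝ (b i) f • b i
  have hf12 : f = f1 + f2 := by
    rw [← b.sum_repr' f]
    exact (Finset.sum_add_sum_compl S _).symm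
  have hfix : ρ h f1 = f1 := by
    simp only [f1, map_sum, map_smul]
    exact Finset.sum_congr rfl fun i hi => by rw [hH h hh i hi]
  have hf2 : ‖f2‖ ^ 2 ≤ α ^ 3 / 4 * n ^ 2 * A.card := by
    have e1 : ‖f2‖ ^ 2 = ∑ i ∈ Sᶜ, (inner ℝ (b i) f) ^ 2 := by
      rw [← real_inner_self_eq_norm_sq]
      have := b.orthonormal.inner_sum (fun i => inner ℝ (b i) f) (fun i => inner ℝ (b i) f) Sᶜ
      rw [this]
      simp [sq]
    have e2 : ‖a‖ ^ 2 = A.card := by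
      rw [← real_inner_self_eq_norm_sq, hinner]
      simp only [ha, hχ2, hχs]
    have e3 : ∀ i ∈ Sᶜ, (inner ℝ (b i) f) ^ 2 ≤ α ^ 3 / 4 * n ^ 2 * (inner ℝ (b i) a) ^ 2 := by
      intro i hi
      rw [hf, ← hTsym, hb, real_inner_smul_left, mul_pow]
      gcongr
      have : ¬ (α ^ 3 / 4 * n ^ 2 ≤ (μ i) ^ 2) := by
        intro hc; exact (Finset.mem_compl.1 hi) (Finset.mem_filter.2 ⟨Finset.mem_univ _, hc⟩)
      exact (not_le.1 this).le
    rw [e1, ← e2]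
    refine (Finset.sum_le_sum e3).trans ?_
    rw [← Finset.mul_sum]
    gcongr
    have := b.sum_sq_norm_inner_right a
    rw [← this]
    refine (Finset.sum_le_sum_of_subset_of_nonneg (Finset.subset_univ _) ?_).trans (le_of_eq ?_)
    · intros; positivity
    · simp
  have hdiff : ‖ρ h f - f‖ ^ 2 ≤ 4 * ‖f2‖ ^ 2 := by
    have e : ρ h f - f = ρ h f2 - f2 := by
      rw [hf12, map_add, hfix]; abel
    have e2 : ‖ρ h f - f‖ ≤ 2 * ‖f2‖ := by
      rw [e]
      refine (norm_sub_le _ _).trans ?_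
      rw [hρn]; linarith
    calc _ ≤ (2 * ‖f2‖) ^ 2 := by gcongr
      _ = _ := by ring
  have hdiff2 : ‖ρ h f - f‖ ^ 2 = 2 * ‖f‖ ^ 2 := by
    rw [@norm_sub_sq_real (EuclideanSpace ℝ G), hzero, hρn]; ring
  have hlow : (A.card : ℝ) ^ 4 ≤ n * ‖f‖ ^ 2 := by
    have e1 : ∑ x, f x = (A.card : ℝ) ^ 2 := by
      simp only [hf, hT, ha]
      rw [Finset.sum_comm]
      have : ∀ y, ∑ x, χ (x⁻¹ * y) * χ y = A.card * χ y := by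
        intro y
        rw [← Finset.sum_mul, ← hχs]
        congr 1
        exact ((Equiv.inv G).trans (Equiv.mulRight y)).sum_comp χ
      simp only [this]
      rw [← Finset.mul_sum, hχs]; ring
    have e2 := sq_sum_le_card_mul_sum_sq (s := (Finset.univ : Finset G)) (f := fun x => f x)
    rw [e1] at e2
    rw [← real_inner_self_eq_norm_sq, hinner]
    simp only [← sq]
    calc _ = ((A.card : ℝ) ^ 2) ^ 2 := by ring
      _ ≤ _ := e2
      _ = _ := by simp [hn]
  set k : ℝ := ((A.card : ℕ) : ℝ) with hk
  have hk0 : 0 < k := lt_of_lt_of_le (by positivity) hcard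
  have h1 : 2 * k ^ 4 ≤ (α * n) ^ 3 * k := by
    calc 2 * k ^ 4 ≤ n * (2 * ‖f‖ ^ 2) := by linarith
      _ ≤ n * (4 * (α ^ 3 / 4 * n ^ 2 * k)) := by
        exact mul_le_mul_of_nonneg_left (by linarith) hn0.le
      _ = _ := by ring
  have h2 : (α * n) ^ 3 * k ≤ k ^ 3 * k := by gcongr
  have h3 : 0 < k ^ 4 := by positivity
  nlinarith
end

section
/- For all positive integers k, m, and r there is a constant C = C(k, m, r) such that the following holds. If G is a group and A ⊆ G is a nonempty finite set with |AA⁻¹A| ≤ k|A| and the subgroup ⟨AA⁻¹⟩ has exponent r, then there is a subgroup H of ⟨AA⁻¹⟩ such that (AA⁻¹)ᵐ is covered by at most C left cosets of H and H ⊆ (AA⁻¹)². -/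
open Pointwise


theorem sabe_spec {W : Type*} [NormedAddCommGroup W] [InnerProductSpace ℝ W] [FiniteDimensional ℝ W]
    (K : W →ₗ[ℝ] W) (hK : K.IsSymmetric) (l : ℝ) (hl : 0 < l) :
    ∃ E : Set W, (∀ v ∈ E, ∃ u ∈ E, K u = v ∧ l * ‖u‖ ≤ ‖v‖) ∧
      ∀ f, ∃ f1, K f1 ∈ E ∧ ‖f1‖ ≤ ‖f‖ ∧ ‖K f - K f1‖ ≤ l * ‖f‖ := by
  classical
  set b := hK.eigenvectorBasis (n := Module.finrank ℝ W) rfl with hb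
  set μ := hK.eigenvalues (n := Module.finrank ℝ W) rfl with hμ
  have hrep : ∀ v i, b.repr (K v) i = μ i * b.repr v i := fun v i => by
    simpa using hK.eigenvectorBasis_apply_self_apply rfl v i
  have hn : ∀ v w : W, ∀ c : ℝ, 0 ≤ c → (∀ i, |b.repr v i| ≤ c * |b.repr w i|) → ‖v‖ ≤ c * ‖w‖ := by
    intro v w c hc h
    rw [← b.repr.norm_map v, ← b.repr.norm_map w, EuclideanSpace.norm_eq, EuclideanSpace.norm_eq]
    rw [Real.sqrt_le_left (by positivity), mul_pow, Real.sq_sqrt (by positivity), Finset.mul_sum]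
    refine Finset.sum_le_sum fun i _ => ?_
    rw [← mul_pow]
    have := h i
    simp only [Real.norm_eq_abs]
    gcongr
  refine ⟨{v | ∀ i, |μ i| < l → b.repr v i = 0}, ?_, ?_⟩
  · intro v hv
    refine ⟨b.repr.symm (WithLp.toLp 2 fun i => b.repr v i / μ i), ?_, ?_, ?_⟩
    · intro i hi
      simp [hv i hi]
    · apply b.repr.injective
      ext i
      rw [hrep]
      simp only [LinearIsometryEquiv.apply_symm_apply]
      by_cases hi : |μ i| < l
      · simp [hv i hi]
      · have : μ i ≠ 0 := by rintro h; simp [h] at hi; linarith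
        field_simp
    · rw [← le_div_iff₀' hl, div_eq_inv_mul]
      apply hn _ _ _ (by positivity)
      intro i
      simp only [LinearIsometryEquiv.apply_symm_apply, abs_div]
      by_cases hi : |μ i| < l
      · simp [hv i hi]
      · rw [div_eq_inv_mul]
        gcongr
        exact not_lt.1 hi
  · intro f
    refine ⟨b.repr.symm (WithLp.toLp 2 fun i => if |μ i| < l then 0 else b.repr f i), ?_, ?_, ?_⟩
    · intro i hi
      rw [hrep]; simp [hi]
    · rw [← one_mul ‖f‖]
      apply hn _ _ _ (by positivity)
      intro i
      simp only [LinearIsometryEquiv.apply_symm_apply]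
      split_ifs <;> simp
    · apply hn _ _ _ hl.le
      intro i
      rw [← map_sub, hrep, map_sub]
      simp only [PiLp.sub_apply, LinearIsometryEquiv.apply_symm_apply, abs_mul]
      split_ifs with hi
      · simp; gcongr
      · simp; positivity

theorem sabe_spec' {H : Type*} [NormedAddCommGroup H] [InnerProductSpace ℝ H]
    (W : Submodule ℝ H) [FiniteDimensional ℝ W]
    (K : H →ₗ[ℝ] H) (hK : K.IsSymmetric) (hW : ∀ x, K x ∈ W) (l : ℝ) (hl : 0 < l) :
    ∃ E : Set H, (∀ v ∈ E, ∃ u ∈ E, K u = v ∧ l * ‖u‖ ≤ ‖v‖) ∧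
      ∀ f ∈ W, ∃ f1, K f1 ∈ E ∧ ‖f1‖ ≤ ‖f‖ ∧ ‖K f - K f1‖ ≤ l * ‖f‖ := by
  obtain ⟨E, h1, h2⟩ := sabe_spec (K.restrict (p := W) (q := W) (fun x _ => hW x))
    (hK.restrict_invariant (fun x _ => hW x)) l hl
  refine ⟨Subtype.val '' E, ?_, ?_⟩
  · rintro _ ⟨v, hv, rfl⟩
    obtain ⟨u, hu, h, h'⟩ := h1 v hv
    exact ⟨u, ⟨u, hu, rfl⟩, congrArg Subtype.val h, h'⟩
  · intro f hf
    obtain ⟨f1, h, h', h''⟩ := h2 ⟨f, hf⟩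
    exact ⟨f1, ⟨_, h, rfl⟩, h', h''⟩

/-- `r • w = - ∑ (λ^i - 1) w` type estimate. -/
theorem sabe_avg {V : Type*} [NormedAddCommGroup V] [NormedSpace ℝ V] (r : ℕ) (hr : 0 < r)
    (p : ℕ → V) (B : ℝ) (h0 : ∑ i ∈ Finset.range r, p i = 0)
    (hB : ∀ i < r, ‖p i - p 0‖ ≤ B) : ‖p 0‖ ≤ B := by
  have h : (r : ℝ) • p 0 = - ∑ i ∈ Finset.range r, (p i - p 0) := by
    rw [Finset.sum_sub_distrib, h0]; simp [Nat.cast_smul_eq_nsmul]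
  have h2 : (r : ℝ) * ‖p 0‖ ≤ r * B := by
    calc (r : ℝ) * ‖p 0‖ = ‖(r : ℝ) • p 0‖ := by rw [norm_smul]; simp
      _ ≤ ∑ i ∈ Finset.range r, ‖p i - p 0‖ := by rw [h, norm_neg]; exact norm_sum_le _ _
      _ ≤ ∑ i ∈ Finset.range r, B := Finset.sum_le_sum fun i hi => hB i (Finset.mem_range.1 hi)
      _ = r * B := by simp
  exact le_of_mul_le_mul_left h2 (by positivity)

theorem sabe_abs {H : Type*} [NormedAddCommGroup H] [InnerProductSpace ℝ H]
    (K : H →ₗ[ℝ] H) (L : ℕ → H →ₗ[ℝ] H) (r : ℕ) (hr : 0 < r)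
    (hiso : ∀ i v, ‖L i v‖ = ‖v‖) (h0 : ∀ v, L 0 v = v)
    (hsucc : ∀ i v, L i (L 1 v) = L (i + 1) v) (hrr : ∀ v, L r v = v)
    (β η l : ℝ) (hβ : 0 ≤ β) (hl : 0 < l) (hη : η ≤ l / 2) (hη0 : 0 ≤ η)
    (hcomm : ∀ v, ‖L 1 (K v) - K (L 1 v)‖ ≤ β * ‖v‖)
    (hsm : ∀ i < r, ∀ v, ‖L i (K v) - K v‖ ≤ η * ‖v‖)
    (E : Set H) (hE : ∀ v ∈ E, ∃ u ∈ E, K u = v ∧ l * ‖u‖ ≤ ‖v‖) :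
    ∀ v ∈ E, ‖L 1 v - v‖ ≤ 4 * β / l * ‖v‖ := by
  have step : ∀ t : ℝ, 0 ≤ t → (∀ v ∈ E, ‖L 1 v - v‖ ≤ t * ‖v‖) →
      ∀ v ∈ E, ‖L 1 v - v‖ ≤ (t / 2 + 2 * β / l) * ‖v‖ := by
    intro t ht h v hv
    obtain ⟨u, hu, rfl, hul⟩ := hE v hv
    set w := L 1 (K u) - K u with hw
    have hlw : ∀ i, L i w = L (i + 1) (K u) - L i (K u) := fun i => by rw [hw, map_sub, hsucc]
    have := sabe_avg r hr (fun i => L i w) ((η * t + 2 * β) * ‖u‖) ?_ ?_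
    · simp only [h0] at this
      refine this.trans ?_
      have h1 : (η * t + 2 * β) ≤ l * (t / 2 + 2 * β / l) := by
        have : l * (t / 2 + 2 * β / l) = l / 2 * t + 2 * β := by field_simp
        rw [this]; gcongr
      calc _ ≤ (l * (t / 2 + 2 * β / l)) * ‖u‖ := by gcongr
        _ = (t / 2 + 2 * β / l) * (l * ‖u‖) := by ring
        _ ≤ _ := by gcongr
    · simp only [hlw]
      rw [Finset.sum_range_sub (fun i => L i (K u))]
      rw [hrr, h0, sub_self]
    · intro i hi
      simp only [h0]
      set e := L 1 (K u) - K (L 1 u) with he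
      have hwe : w = K (L 1 u - u) + e := by rw [map_sub]; simp only [hw, he]; abel
      have h2 : L i w - w = (L i (K (L 1 u - u)) - K (L 1 u - u)) + (L i e - e) := by
        rw [hwe, map_add]; abel
      have h3 := hsm i hi (L 1 u - u)
      have h4 : ‖L i e - e‖ ≤ 2 * (β * ‖u‖) := by
        calc _ ≤ ‖L i e‖ + ‖e‖ := norm_sub_le _ _
          _ = 2 * ‖e‖ := by rw [hiso]; ring
          _ ≤ _ := by have := hcomm u; gcongr
      calc _ ≤ η * ‖L 1 u - u‖ + 2 * (β * ‖u‖) := by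
            rw [h2]; exact (norm_add_le _ _).trans (add_le_add h3 h4)
        _ ≤ η * (t * ‖u‖) + 2 * (β * ‖u‖) := by have := h u hu; gcongr
        _ = _ := by ring
  have iter : ∀ m : ℕ, ∀ v ∈ E, ‖L 1 v - v‖ ≤ (2 * (1 / 2) ^ m + 4 * β / l) * ‖v‖ := by
    intro m
    induction m with
    | zero =>
      intro v hv
      calc _ ≤ ‖L 1 v‖ + ‖v‖ := norm_sub_le _ _
        _ = 2 * ‖v‖ := by rw [hiso]; ring
        _ ≤ _ := by gcongr; have : 0 ≤ 4 * β / l := by positivity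
                    linarith
    | succ m ih =>
      intro v hv
      refine (step _ (by positivity) ih v hv).trans (le_of_eq ?_)
      ring
  intro v hv
  have : Filter.Tendsto (fun m : ℕ => (2 * (1 / 2 : ℝ) ^ m + 4 * β / l) * ‖v‖) Filter.atTop
      (nhds ((2 * 0 + 4 * β / l) * ‖v‖)) :=
    (((tendsto_pow_atTop_nhds_zero_of_lt_one (by norm_num) (by norm_num)).const_mul _).add_const _).mul_const _
  have h2 := ge_of_tendsto' this (fun m => iter m v hv)
  simpa using h2


abbrev SabeH (G : Type) := lp (fun _ : G => ℝ) 2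

theorem sabe_normsq {G : Type} (f : SabeH G) : HasSum (fun x => f x ^ 2) (‖f‖ ^ 2) := by
  have := lp.hasSum_norm (p := 2) (by norm_num) f
  simpa using this

theorem sabe_sum_le {G : Type} (f : SabeH G) (s : Finset G) : ∑ x ∈ s, f x ^ 2 ≤ ‖f‖ ^ 2 :=
  sum_le_hasSum s (fun _ _ => sq_nonneg _) (sabe_normsq f)

theorem sabe_norm_eq {G : Type} (f : SabeH G) (s : Finset G) (h : ∀ x ∉ s, f x = 0) :
    ‖f‖ ^ 2 = ∑ x ∈ s, f x ^ 2 :=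
  (sabe_normsq f).unique (hasSum_sum_of_ne_finset_zero (fun x hx => by simp [h x hx]))

noncomputable def sabePull {G : Type} (e : G ≃ G) : SabeH G →ₗ[ℝ] SabeH G where
  toFun f := ⟨fun x => f (e x), by
    have h := (sabe_normsq f).summable
    refine memℓp_gen ?_
    have := (e.summable_iff (f := fun x => f x ^ 2)).2 h
    simpa [Function.comp_def] using this⟩
  map_add' f g := by ext x; rfl
  map_smul' c f := by ext x; rfl

@[simp] theorem sabePull_apply {G : Type} (e : G ≃ G) (f : SabeH G) (x : G) :
    sabePull e f x = f (e x) := rfl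

theorem sabePull_norm {G : Type} (e : G ≃ G) (f : SabeH G) : ‖sabePull e f‖ = ‖f‖ := by
  have h1 := sabe_normsq (sabePull e f)
  have h2 := (e.hasSum_iff (f := fun x => f x ^ 2)).2 (sabe_normsq f)
  have := h1.unique h2
  exact (pow_left_inj₀ (norm_nonneg _) (norm_nonneg _) two_ne_zero).1 this

theorem sabePull_inner {G : Type} (e : G ≃ G) (f g : SabeH G) :
    inner ℝ (sabePull e f) g = inner ℝ f (sabePull e.symm g) := by
  have h1 := lp.hasSum_inner (𝕜 := ℝ) (sabePull e f) g
  have h2 := lp.hasSum_inner (𝕜 := ℝ) f (sabePull e.symm g)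
  have h3 := (e.hasSum_iff (f := fun i => inner ℝ (f i) (sabePull e.symm g i))).2 h2
  refine h1.unique ?_
  have h4 : (fun i => inner ℝ (sabePull e f i) (g i)) =
      (fun i => inner ℝ (f i) (sabePull e.symm g i)) ∘ e := by
    ext x; simp
  rw [h4]; exact h3

noncomputable def sabeMul {G : Type} (F : G → ℝ) (B : ℝ) (hF : ∀ x, |F x| ≤ B) :
    SabeH G →ₗ[ℝ] SabeH G where
  toFun f := ⟨fun x => F x * f x, by
    refine Memℓp.mono (g := fun x => B * |f x|) ?_ ?_
    · exact ((memℓp_norm_iff.2 (lp.memℓp f)).const_mul B)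
    · intro x
      simp only [Real.norm_eq_abs, abs_mul]
      have := hF x
      gcongr⟩
  map_add' f g := by ext x; exact mul_add _ _ _
  map_smul' c f := by ext x; simp; ring

@[simp] theorem sabeMul_apply {G : Type} (F : G → ℝ) (B : ℝ) (hF : ∀ x, |F x| ≤ B) (f : SabeH G)
    (x : G) : sabeMul F B hF f x = F x * f x := rfl

theorem sabe_norm_le {G : Type} (f g : SabeH G) (B : ℝ) (hB : 0 ≤ B) (h : ∀ x, |f x| ≤ B * |g x|) :
    ‖f‖ ≤ B * ‖g‖ := by
  have h1 := sabe_normsq f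
  have h2 := (sabe_normsq g).mul_left (B ^ 2)
  have := hasSum_le (fun x => ?_) h1 h2
  · rw [← mul_pow] at this
    exact (pow_le_pow_iff_left₀ (norm_nonneg _) (by positivity) two_ne_zero).1 this
  · rw [← sq_abs, ← sq_abs (g x), ← mul_pow]
    have := h x
    gcongr

theorem sabeMul_inner {G : Type} (F : G → ℝ) (B : ℝ) (hF : ∀ x, |F x| ≤ B) (f g : SabeH G) :
    inner ℝ (sabeMul F B hF f) g = inner ℝ f (sabeMul F B hF g) := by
  rw [lp.inner_eq_tsum, lp.inner_eq_tsum]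
  congr 1; ext x; simp; ring

noncomputable def sabeL {G : Type} [Group G] (g : G) : SabeH G →ₗ[ℝ] SabeH G :=
  sabePull (Equiv.mulLeft g⁻¹)

noncomputable def sabeT {G : Type} [Group G] (S : Finset G) (ψ : G → ℝ) : SabeH G →ₗ[ℝ] SabeH G :=
  ∑ s ∈ S, ψ s • sabePull (Equiv.mulRight s)

@[simp] theorem sabeL_apply {G : Type} [Group G] (g : G) (f : SabeH G) (x : G) :
    sabeL g f x = f (g⁻¹ * x) := rfl

theorem sabeT_apply {G : Type} [Group G] (S : Finset G) (ψ : G → ℝ) (f : SabeH G) (x : G) :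
    sabeT S ψ f x = ∑ s ∈ S, ψ s * f (x * s) := by
  rw [sabeT, LinearMap.sum_apply, lp.coeFn_sum]
  exact (Finset.sum_apply x S _).trans rfl

theorem sabeL_norm {G : Type} [Group G] (g : G) (f : SabeH G) : ‖sabeL g f‖ = ‖f‖ := sabePull_norm _ _

theorem sabeT_norm {G : Type} [Group G] (S : Finset G) (ψ : G → ℝ) (h0 : ∀ x, 0 ≤ ψ x)
    (h1 : ∑ s ∈ S, ψ s = 1) (f : SabeH G) : ‖sabeT S ψ f‖ ≤ ‖f‖ := by
  rw [sabeT, LinearMap.sum_apply]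
  refine (norm_sum_le _ _).trans ?_
  simp only [LinearMap.smul_apply, norm_smul, sabePull_norm, Real.norm_eq_abs, abs_of_nonneg (h0 _)]
  rw [← Finset.sum_mul, h1, one_mul]

theorem sabeT_inner {G : Type} [Group G] (S : Finset G) (ψ : G → ℝ) (hS : ∀ s ∈ S, s⁻¹ ∈ S)
    (hψ : ∀ x, ψ x⁻¹ = ψ x) (f g : SabeH G) :
    inner ℝ (sabeT S ψ f) g = inner ℝ f (sabeT S ψ g) := by
  simp only [sabeT, LinearMap.sum_apply, sum_inner, inner_sum, LinearMap.smul_apply,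
    real_inner_smul_left, real_inner_smul_right, sabePull_inner]
  refine Finset.sum_nbij' (fun s => s⁻¹) (fun s => s⁻¹) hS hS (by simp) (by simp) ?_
  intro s hs
  simp [hψ]

theorem sabeT_eq {G : Type} [Group G] (S : Finset G) (ψ : G → ℝ)
    (hψ : ∀ x, ψ x⁻¹ = ψ x) (hψS : ∀ x ∉ S, ψ x = 0) (Ω : Finset G) (f : G → ℝ)
    (hf : ∀ x ∉ Ω, f x = 0) (x : G) : ∑ s ∈ S, ψ s * f (x * s) = ∑ y ∈ Ω, f y * ψ (y⁻¹ * x) := by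
  classical
  have h1 : ∑ s ∈ S, ψ s * f (x * s) = ∑ y ∈ S.image (fun s => x * s), f y * ψ (y⁻¹ * x) := by
    rw [Finset.sum_image (by intro a _ b _ h; simpa using h)]
    refine Finset.sum_congr rfl fun s _ => ?_
    rw [← hψ ((x * s)⁻¹ * x)]; simp [mul_comm]
  have h2 : ∀ y ∉ S.image (fun s => x * s), f y * ψ (y⁻¹ * x) = 0 := by
    intro y hy
    rw [← hψ]
    rw [hψS, mul_zero]
    intro h
    exact hy (Finset.mem_image.2 ⟨_, h, by simp⟩)
  rw [h1, Finset.sum_subset (Finset.subset_union_left (s₂ := Ω)) (fun y _ hy => h2 y hy)]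
  exact (Finset.sum_subset Finset.subset_union_right (fun y _ hy => by simp [hf y hy])).symm

theorem sabe_ops {G : Type} [Group G] (S : Finset G) (ψ : G → ℝ) (h0 : ∀ x, 0 ≤ ψ x)
    (h1 : ∑ s ∈ S, ψ s = 1)
    (hψ : ∀ x, ψ x⁻¹ = ψ x) (hψS : ∀ x ∉ S, ψ x = 0) (Ω : Finset G) (F : G → ℝ)
    (hF : ∀ x, |F x| ≤ 1) (hΩ : ∀ x ∉ Ω, F x = 0) (h : G) (β : ℝ) (hβ0 : 0 ≤ β)
    (hβ : ∀ x, |F (h⁻¹ * x) - F x| ≤ β) (v : SabeH G) :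
    ‖sabeL h (sabeMul F 1 hF (sabeT S ψ (sabeMul F 1 hF v))) -
      sabeMul F 1 hF (sabeT S ψ (sabeMul F 1 hF (sabeL h v)))‖ ≤ 2 * β * ‖v‖ ∧
    ∀ ε : ℝ, 0 ≤ ε → (∀ y ∈ Ω, ∀ z, |ψ (y⁻¹ * h⁻¹ * z) - ψ (y⁻¹ * z)| ≤ ε) →
    ‖sabeL h (sabeMul F 1 hF (sabeT S ψ (sabeMul F 1 hF v))) -
      sabeMul F 1 hF (sabeT S ψ (sabeMul F 1 hF v))‖ ≤ (β + Ω.card * ε) * ‖v‖ := by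
  set M := sabeMul F 1 hF with hM
  set T := sabeT S ψ with hT
  have hMn : ∀ f, ‖M f‖ ≤ ‖f‖ := fun f => by
    have := sabe_norm_le (M f) f 1 zero_le_one (fun x => by
      rw [hM, sabeMul_apply, abs_mul]; have := hF x; gcongr)
    simpa using this
  have hTn : ∀ f, ‖T f‖ ≤ ‖f‖ := sabeT_norm S ψ h0 h1
  have hLM : ∀ f, ‖sabeL h (M f) - M (sabeL h f)‖ ≤ β * ‖f‖ := fun f => by
    rw [← sabeL_norm h f]
    apply sabe_norm_le _ _ _ hβ0
    intro x
    have : (sabeL h (M f) - M (sabeL h f)) x = (F (h⁻¹ * x) - F x) * sabeL h f x := by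
      simp [hM]; ring
    rw [this, abs_mul]
    have := hβ x
    gcongr
  have hLT : ∀ f, sabeL h (T f) = T (sabeL h f) := fun f => by
    ext x; simp [hT, sabeT_apply, mul_assoc]
  constructor
  · have : sabeL h (M (T (M v))) - M (T (M (sabeL h v))) =
        (sabeL h (M (T (M v))) - M (sabeL h (T (M v)))) + M (T (sabeL h (M v) - M (sabeL h v))) := by
      rw [map_sub, map_sub, hLT]; abel
    rw [this]
    refine (norm_add_le _ _).trans ?_
    have a1 := hLM (T (M v))
    have a2 := (hTn (M v)).trans (hMn v)
    have a3 := (hMn _).trans ((hTn (sabeL h (M v) - M (sabeL h v))).trans (hLM v))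
    have : β * ‖T (M v)‖ ≤ β * ‖v‖ := by gcongr
    linarith
  · intro ε hε hy
    set u := M v with hu
    have hu0 : ∀ x ∉ Ω, u x = 0 := fun x hx => by simp [hu, hM, hΩ x hx]
    have : sabeL h (M (T u)) - M (T u) = (sabeL h (M (T u)) - M (sabeL h (T u))) +
        M (sabeL h (T u) - T u) := by rw [map_sub]; abel
    rw [this]
    refine (norm_add_le _ _).trans ?_
    have a1 := hLM (T u)
    have a2 := (hTn u).trans (hMn v)
    have a3 : β * ‖T u‖ ≤ β * ‖v‖ := by gcongr
    have huv : ∑ y ∈ Ω, |u y| ≤ √(Ω.card) * ‖v‖ := by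
      have b1 := Finset.sum_mul_sq_le_sq_mul_sq Ω (fun _ => 1) (fun y => |u y|)
      simp only [one_mul, one_pow, Finset.sum_const, nsmul_eq_mul, mul_one, sq_abs] at b1
      have b2 := sabe_sum_le u Ω
      have b3 := hMn v
      apply le_of_sq_le_sq _ (by positivity)
      rw [mul_pow, Real.sq_sqrt (by positivity)]
      refine b1.trans ?_
      have : ‖u‖ ^ 2 ≤ ‖v‖ ^ 2 := by gcongr
      gcongr
      exact b2.trans this
    have hpt : ∀ x, |(sabeL h (T u) - T u) x| ≤ ε * (√(Ω.card) * ‖v‖) := by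
      intro x
      have e : (sabeL h (T u) - T u) x = ∑ y ∈ Ω, u y * (ψ (y⁻¹ * h⁻¹ * x) - ψ (y⁻¹ * x)) := by
        simp only [lp.coeFn_sub, Pi.sub_apply, sabeL_apply, hT, sabeT_apply]
        rw [sabeT_eq S ψ hψ hψS Ω _ hu0, sabeT_eq S ψ hψ hψS Ω _ hu0, ← Finset.sum_sub_distrib]
        refine Finset.sum_congr rfl fun y _ => ?_
        rw [mul_sub, mul_assoc]
      rw [e]
      refine (Finset.abs_sum_le_sum_abs _ _).trans ?_
      calc _ ≤ ∑ y ∈ Ω, ε * |u y| := by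
            refine Finset.sum_le_sum fun y hyΩ => ?_
            rw [abs_mul, mul_comm]
            have := hy y hyΩ x
            gcongr
        _ ≤ _ := by rw [← Finset.mul_sum]; gcongr
    have a4 : ‖M (sabeL h (T u) - T u)‖ ≤ Ω.card * ε * ‖v‖ := by
      set w := sabeL h (T u) - T u
      apply le_of_sq_le_sq _ (by positivity)
      rw [sabe_norm_eq (M w) Ω (fun x hx => by simp [hM, hΩ x hx])]
      calc _ ≤ ∑ x ∈ Ω, (ε * (√(Ω.card) * ‖v‖)) ^ 2 := by
            refine Finset.sum_le_sum fun x _ => ?_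
            rw [← sq_abs]
            have c1 := hpt x
            have c2 : |M w x| ≤ |w x| := by
              rw [hM, sabeMul_apply, abs_mul]
              have := mul_le_mul_of_nonneg_right (hF x) (abs_nonneg (w x))
              simpa using this
            gcongr
            exact c2.trans c1
        _ = _ := by
            rw [Finset.sum_const, nsmul_eq_mul, mul_pow, mul_pow, Real.sq_sqrt (by positivity)]; ring
    linarith

noncomputable def sabeW {G : Type} (Ω : Finset G) : Submodule ℝ (SabeH G) where
  carrier := {f | ∀ x ∉ Ω, f x = 0}
  add_mem' := by intro a b ha hb x hx; simp [ha x hx, hb x hx]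
  zero_mem' := by intro x _; simp
  smul_mem' := by intro c a ha x hx; simp [ha x hx]

instance sabeW_fin {G : Type} (Ω : Finset G) : FiniteDimensional ℝ (sabeW Ω) := by
  let φ : sabeW Ω →ₗ[ℝ] (Ω → ℝ) :=
    { toFun := fun f x => f.1 x
      map_add' := by intro a b; ext x; simp
      map_smul' := by intro a b; ext x; simp }
  refine FiniteDimensional.of_injective φ ?_
  intro a b hab
  ext x
  by_cases hx : x ∈ Ω
  · exact congrFun hab ⟨x, hx⟩
  · rw [a.2 x hx, b.2 x hx]


section
variable {G : Type} [Group G] [DecidableEq G]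

def sabeD (Y : Finset G) (g : G) : ℕ := (g • Y \ Y).card

theorem sabeD_mul (Y : Finset G) (g h : G) : sabeD Y (g * h) ≤ sabeD Y g + sabeD Y h := by
  unfold sabeD
  have h1 : (g * h) • Y \ Y ⊆ (g • Y \ Y) ∪ g • (h • Y \ Y) := by
    intro x hx
    rw [mul_smul, Finset.mem_sdiff] at hx
    rw [Finset.mem_union, Finset.mem_sdiff, Finset.smul_finset_sdiff, Finset.mem_sdiff]
    tauto
  refine (Finset.card_le_card h1).trans ((Finset.card_union_le _ _).trans ?_)
  rw [Finset.card_smul_finset]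

theorem sabeD_inv (Y : Finset G) (g : G) : sabeD Y g⁻¹ = sabeD Y g := by
  unfold sabeD
  have h1 : (g⁻¹ • Y \ Y).card = (Y \ g • Y).card := by
    rw [← Finset.card_smul_finset g, Finset.smul_finset_sdiff, smul_inv_smul]
  rw [h1]
  exact Finset.card_sdiff_comm (by simp)

theorem sabeD_pow (Y : Finset G) (g : G) (i : ℕ) : sabeD Y (g ^ i) ≤ i * sabeD Y g := by
  induction i with
  | zero => simp [sabeD]
  | succ i ih =>
    rw [pow_succ]
    have := sabeD_mul Y (g ^ i) g
    linarith

noncomputable def sabePsi (Y : Finset G) (x : G) : ℝ := ((Y ∩ x • Y).card : ℝ) / (Y.card : ℝ) ^ 2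

theorem sabePsi_nonneg (Y : Finset G) (x : G) : 0 ≤ sabePsi Y x := by unfold sabePsi; positivity

theorem sabePsi_inv (Y : Finset G) (x : G) : sabePsi Y x⁻¹ = sabePsi Y x := by
  unfold sabePsi
  rw [← Finset.card_smul_finset x (Y ∩ x⁻¹ • Y), Finset.smul_finset_inter, smul_inv_smul,
    Finset.inter_comm]

theorem sabePsi_supp (Y : Finset G) (x : G) (hx : sabePsi Y x ≠ 0) : x ∈ Y * Y⁻¹ := by
  by_contra h
  apply hx
  unfold sabePsi
  rw [Finset.card_eq_zero.2, Nat.cast_zero, zero_div]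
  rw [Finset.eq_empty_iff_forall_notMem]
  intro a ha
  rw [Finset.mem_inter, Finset.mem_smul_finset] at ha
  obtain ⟨ha, b, hb, rfl⟩ := ha
  exact h (Finset.mem_mul.2 ⟨_, ha, b⁻¹, Finset.inv_mem_inv hb, by simp⟩)

theorem sabe_sum_inter (Y S : Finset G) (hS : Y * Y⁻¹ ⊆ S) :
    ∑ x ∈ S, (Y ∩ x • Y).card = Y.card ^ 2 := by
  have h1 : ∀ x, (Y ∩ x • Y).card = ((Y ×ˢ Y).filter (fun p => p.1 * p.2⁻¹ = x)).card := by
    intro x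
    refine (Finset.card_nbij' (fun p => p.1) (fun a => (a, x⁻¹ * a)) ?_ ?_ ?_ ?_).symm
    · rintro ⟨a, b⟩ h
      simp only [Finset.coe_filter, Finset.mem_product, Set.mem_setOf_eq] at h
      simp only [Finset.coe_inter, Set.mem_inter_iff, Finset.mem_coe, Finset.mem_smul_finset]
      exact ⟨h.1.1, b, h.1.2, by rw [← h.2]; simp⟩
    · intro a h
      simp only [Finset.coe_inter, Set.mem_inter_iff, Finset.mem_coe, Finset.mem_smul_finset] at h
      obtain ⟨h, b, hb, rfl⟩ := h
      simp only [Finset.coe_filter, Finset.mem_product, Set.mem_setOf_eq]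
      refine ⟨⟨h, by simpa using hb⟩, by simp⟩
    · rintro ⟨a, b⟩ h
      simp only [Finset.coe_filter, Finset.mem_product, Set.mem_setOf_eq] at h
      simp [← h.2]
    · intro a h; simp
  simp only [h1]
  rw [← Finset.card_eq_sum_card_fiberwise, Finset.card_product, sq]
  rintro ⟨a, b⟩ h
  simp only [Finset.coe_product, Set.mem_prod, Finset.mem_coe] at h
  exact hS (Finset.mul_mem_mul h.1 (Finset.inv_mem_inv h.2))

theorem sabePsi_sum (Y S : Finset G) (hY : Y.Nonempty) (hS : Y * Y⁻¹ ⊆ S) :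
    ∑ x ∈ S, sabePsi Y x = 1 := by
  unfold sabePsi
  rw [← Finset.sum_div, ← Nat.cast_sum, sabe_sum_inter Y S hS]
  have : (Y.card : ℝ) ≠ 0 := by exact_mod_cast hY.card_pos.ne'
  push_cast
  field_simp

theorem sabePsi_lip (Y : Finset G) (hY : Y.Nonempty) (k z : G) :
    |sabePsi Y (k * z) - sabePsi Y z| ≤ sabeD Y k / (Y.card : ℝ) ^ 2 := by
  unfold sabePsi
  have h1 : (Y ∩ (k * z) • Y).card = (k⁻¹ • Y ∩ z • Y).card := by
    rw [← Finset.card_smul_finset k⁻¹, Finset.smul_finset_inter, mul_smul, inv_smul_smul]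
  rw [h1, ← sub_div, abs_div, abs_of_pos (a := (Y.card : ℝ) ^ 2) (by have := hY.card_pos; positivity)]
  gcongr
  have h2 : (k⁻¹ • Y ∩ z • Y).card ≤ (Y ∩ z • Y).card + sabeD Y k := by
    rw [← sabeD_inv]
    refine (Finset.card_le_card (t := (Y ∩ z • Y) ∪ (k⁻¹ • Y \ Y)) ?_).trans (Finset.card_union_le _ _)
    intro x; simp only [Finset.mem_inter, Finset.mem_union, Finset.mem_sdiff]; tauto
  have h3 : (Y ∩ z • Y).card ≤ (k⁻¹ • Y ∩ z • Y).card + sabeD Y k := by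
    have : sabeD Y k = (Y \ k⁻¹ • Y).card := by
      rw [← sabeD_inv]; exact Finset.card_sdiff_comm (by simp)
    rw [this]
    refine (Finset.card_le_card (t := (k⁻¹ • Y ∩ z • Y) ∪ (Y \ k⁻¹ • Y)) ?_).trans
      (Finset.card_union_le _ _)
    intro x; simp only [Finset.mem_inter, Finset.mem_union, Finset.mem_sdiff]; tauto
  rw [abs_le]
  have h2' : ((k⁻¹ • Y ∩ z • Y).card : ℝ) ≤ (Y ∩ z • Y).card + sabeD Y k := by exact_mod_cast h2
  have h3' : ((Y ∩ z • Y).card : ℝ) ≤ (k⁻¹ • Y ∩ z • Y).card + sabeD Y k := by exact_mod_cast h3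
  constructor <;> linarith

/-- combined estimate -/
theorem sabePsi_conj (Y : Finset G) (hY : Y.Nonempty) (q y : G) (δ : ℝ) (r i : ℕ) (hi : i ≤ r)
    (hd : (sabeD Y (y⁻¹ * q * y) : ℝ) ≤ δ * Y.card) (z : G) :
    |sabePsi Y (y⁻¹ * (q ^ i)⁻¹ * z) - sabePsi Y (y⁻¹ * z)| ≤ r * δ / Y.card := by
  have hYp : (0 : ℝ) < Y.card := by exact_mod_cast hY.card_pos
  have h1 := sabePsi_lip Y hY ((y⁻¹ * q * y) ^ i)⁻¹ (y⁻¹ * z)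
  have h2 : (y⁻¹ * q * y) ^ i = y⁻¹ * q ^ i * y := by
    have := conj_pow (i := i) (a := y⁻¹) (b := q)
    simpa using this
  have h3 : ((y⁻¹ * q * y) ^ i)⁻¹ * (y⁻¹ * z) = y⁻¹ * (q ^ i)⁻¹ * z := by rw [h2]; group
  rw [h3, sabeD_inv] at h1
  refine h1.trans ?_
  have h4 : (sabeD Y ((y⁻¹ * q * y) ^ i) : ℝ) ≤ i * sabeD Y (y⁻¹ * q * y) := by
    exact_mod_cast sabeD_pow Y (y⁻¹ * q * y) i
  have h5 : (i : ℝ) * sabeD Y (y⁻¹ * q * y) ≤ r * (δ * Y.card) := by gcongr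
  rw [div_le_div_iff₀ (by positivity) hYp]
  calc _ ≤ (r * (δ * Y.card)) * Y.card := by gcongr; exact h4.trans h5
    _ = _ := by ring

noncomputable def sabePhi (Q P : Finset G) (n : ℕ) (x : G) : ℝ :=
  (((Finset.range n).filter (fun j => x ∈ Q ^ j * P)).card : ℝ) / n

theorem sabePhi_bd (Q P : Finset G) (n : ℕ) (x : G) : 0 ≤ sabePhi Q P n x ∧ sabePhi Q P n x ≤ 1 := by
  unfold sabePhi
  refine ⟨by positivity, div_le_one_of_le₀ ?_ (by positivity)⟩
  have := Finset.card_filter_le (Finset.range n) (fun j => x ∈ Q ^ j * P)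
  rw [Finset.card_range] at this
  exact_mod_cast this

theorem sabePhi_one (Q P : Finset G) (hQ : 1 ∈ Q) (n : ℕ) (hn : 0 < n) (x : G) (hx : x ∈ P) :
    sabePhi Q P n x = 1 := by
  unfold sabePhi
  rw [Finset.filter_true_of_mem, Finset.card_range, div_self (by positivity)]
  intro j _
  rw [← one_mul x]
  exact Finset.mul_mem_mul (Finset.one_mem_pow hQ) hx

theorem sabePhi_supp (Q P : Finset G) (hQ : 1 ∈ Q) (n : ℕ) (x : G) (hx : sabePhi Q P (n + 1) x ≠ 0) :
    x ∈ Q ^ n * P := by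
  by_contra h
  apply hx
  unfold sabePhi
  rw [Finset.filter_false_of_mem, Finset.card_empty, Nat.cast_zero, zero_div]
  intro j hj h'
  exact h (Finset.mul_subset_mul_right (Finset.pow_subset_pow_right hQ
    (by have := Finset.mem_range.1 hj; omega)) h')

theorem sabePhi_lip (Q P : Finset G) (hQ : Q⁻¹ = Q) (n : ℕ) (hn : 0 < n) (q : G) (hq : q ∈ Q)
    (x : G) : |sabePhi Q P n (q⁻¹ * x) - sabePhi Q P n x| ≤ 1 / n := by
  have key : ∀ q ∈ Q, ∀ x : G, ((Finset.range n).filter (fun j => x ∈ Q ^ j * P)).card ≤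
      ((Finset.range n).filter (fun j => q * x ∈ Q ^ j * P)).card + 1 := by
    intro q hq x
    rw [← Nat.sub_le_iff_le_add]
    refine (Finset.pred_card_le_card_erase (a := n - 1)).trans ?_
    refine Finset.card_le_card_of_injOn (fun j => j + 1) ?_ (by intro a _ b _ h; simpa using h)
    intro j hj
    simp only [Finset.coe_erase, Finset.coe_filter, Finset.mem_range, Set.mem_diff,
      Set.mem_setOf_eq, Set.mem_singleton_iff] at hj
    simp only [Finset.coe_filter, Finset.mem_range, Set.mem_setOf_eq]
    refine ⟨by omega, ?_⟩
    rw [pow_succ', mul_assoc]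
    exact Finset.mul_mem_mul hq hj.1.2
  have hq' : q⁻¹ ∈ Q := by rw [← hQ]; exact Finset.inv_mem_inv hq
  have k1 := key q⁻¹ hq' x
  have k2 := key q hq (q⁻¹ * x)
  rw [mul_inv_cancel_left] at k2
  unfold sabePhi
  rw [← sub_div, abs_div, abs_of_pos (a := (n : ℝ)) (by positivity)]
  gcongr
  rw [abs_le]
  have k1' : (((Finset.range n).filter (fun j => x ∈ Q ^ j * P)).card : ℝ) ≤
      ((Finset.range n).filter (fun j => q⁻¹ * x ∈ Q ^ j * P)).card + 1 := by exact_mod_cast k1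
  have k2' : (((Finset.range n).filter (fun j => q⁻¹ * x ∈ Q ^ j * P)).card : ℝ) ≤
      ((Finset.range n).filter (fun j => x ∈ Q ^ j * P)).card + 1 := by exact_mod_cast k2
  constructor <;> linarith

end

section
variable {G : Type} [Group G] [DecidableEq G]

theorem sabe_Flip (Y S Λ : Finset G) (hY : Y.Nonempty) (hS : Y * Y⁻¹ ⊆ S) (φ : G → ℝ) (q : G)
    (r : ℕ) (hr : 0 < r) (hq : q ^ r = 1) (hφ : ∀ y ∉ Λ, φ (q⁻¹ * y) - φ y = 0) (b δ : ℝ)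
    (hb0 : 0 ≤ b) (hb : ∀ y, |φ (q⁻¹ * y) - φ y| ≤ b)
    (hd : ∀ y ∈ Λ, (sabeD Y (y⁻¹ * q * y) : ℝ) ≤ δ * Y.card) (x : G) :
    |∑ s ∈ S, sabePsi Y s * φ (q⁻¹ * x * s) - ∑ s ∈ S, sabePsi Y s * φ (x * s)| ≤
      Λ.card * (b * (r * δ / Y.card)) := by
  set F : G → ℝ := fun x => ∑ s ∈ S, sabePsi Y s * φ (x * s) with hF
  have hψS : ∀ x ∉ S, sabePsi Y x = 0 := fun x hx => by
    by_contra h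
    exact hx (hS (sabePsi_supp Y x h))
  have hp : ∀ i : ℕ, F ((q ^ (i + 1))⁻¹ * x) - F ((q ^ i)⁻¹ * x) =
      ∑ y ∈ Λ, (φ (q⁻¹ * y) - φ y) * sabePsi Y (y⁻¹ * (q ^ i)⁻¹ * x) := by
    intro i
    have := sabeT_eq S (sabePsi Y) (sabePsi_inv Y) hψS Λ (fun y => φ (q⁻¹ * y) - φ y) hφ
      ((q ^ i)⁻¹ * x)
    simp only [← mul_assoc] at this
    rw [← this, hF]
    simp only
    rw [← Finset.sum_sub_distrib]
    refine Finset.sum_congr rfl fun s _ => ?_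
    rw [pow_succ, mul_inv_rev, mul_sub]
  have := sabe_avg r hr (fun i => F ((q ^ (i + 1))⁻¹ * x) - F ((q ^ i)⁻¹ * x))
    (Λ.card * (b * (r * δ / Y.card))) ?_ ?_
  · simpa [hF] using this
  · rw [Finset.sum_range_sub (fun i => F ((q ^ i)⁻¹ * x)), hq]; simp
  · intro i hi
    simp only [hp]
    rw [← Finset.sum_sub_distrib, Real.norm_eq_abs]
    refine (Finset.abs_sum_le_sum_abs _ _).trans ?_
    rw [← nsmul_eq_mul]
    refine Finset.sum_le_card_nsmul _ _ _ fun y hy => ?_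
    rw [← mul_sub, abs_mul]
    have h1 := hb y
    have h2 := sabePsi_conj Y hY q y δ r i hi.le (hd y hy) x
    have h3 : |sabePsi Y (y⁻¹ * (q ^ i)⁻¹ * x) - sabePsi Y (y⁻¹ * (q ^ 0)⁻¹ * x)| ≤
        r * δ / Y.card := by simpa using h2
    gcongr
end

theorem sabe_op {G : Type} [Group G] [DecidableEq G] (S : Finset G) (ψ : G → ℝ) (h0 : ∀ x, 0 ≤ ψ x)
    (h1 : ∑ s ∈ S, ψ s = 1) (hS : ∀ s ∈ S, s⁻¹ ∈ S)
    (hψ : ∀ x, ψ x⁻¹ = ψ x) (hψS : ∀ x ∉ S, ψ x = 0) (Ω : Finset G) (F : G → ℝ)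
    (hF : ∀ x, |F x| ≤ 1) (hΩ : ∀ x ∉ Ω, F x = 0) (Q : Finset G) (r : ℕ) (hr : 0 < r)
    (hQr : ∀ q ∈ Q, q ^ r = 1) (β ε l : ℝ) (hβ0 : 0 ≤ β) (hε : 0 ≤ ε) (hl : 0 < l)
    (hβ : ∀ q ∈ Q, ∀ x, |F (q⁻¹ * x) - F x| ≤ β)
    (hψε : ∀ q ∈ Q, ∀ i < r, ∀ y ∈ Ω, ∀ z, |ψ (y⁻¹ * (q ^ i)⁻¹ * z) - ψ (y⁻¹ * z)| ≤ ε)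
    (hη : r * β + Ω.card * ε ≤ l / 2) (m : ℕ) (g : G) (hg : g ∈ Q ^ m) (f : SabeH G)
    (hf : f ∈ sabeW Ω) :
    ‖sabeL g (sabeMul F 1 hF (sabeT S ψ (sabeMul F 1 hF f))) -
      sabeMul F 1 hF (sabeT S ψ (sabeMul F 1 hF f))‖ ≤ (m * (8 * β / l) + 2 * l) * ‖f‖ := by
  set M := sabeMul F 1 hF with hM
  set T := sabeT S ψ with hT
  set K : SabeH G →ₗ[ℝ] SabeH G := M ∘ₗ T ∘ₗ M with hK
  have hKe : ∀ v, M (T (M v)) = K v := fun v => rfl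
  have hMn : ∀ f, ‖M f‖ ≤ ‖f‖ := fun f => by
    have := sabe_norm_le (M f) f 1 zero_le_one (fun x => by
      rw [hM, sabeMul_apply, abs_mul]; have := hF x; gcongr)
    simpa using this
  have hTn : ∀ f, ‖T f‖ ≤ ‖f‖ := sabeT_norm S ψ h0 h1
  have hKn : ∀ f, ‖K f‖ ≤ ‖f‖ := fun f => (hMn _).trans ((hTn _).trans (hMn _))
  have hKs : K.IsSymmetric := by
    intro x y
    rw [← hKe, ← hKe, hM, hT, sabeMul_inner, sabeT_inner S ψ hS hψ, sabeMul_inner]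
  have hKW : ∀ x, K x ∈ sabeW Ω := by
    intro x y hy
    rw [← hKe, hM, sabeMul_apply, hΩ y hy, zero_mul]
  obtain ⟨E, hE1, hE2⟩ := sabe_spec' (sabeW Ω) K hKs hKW l hl
  have hLone : ∀ v : SabeH G, sabeL 1 v = v := fun v => by ext x; simp
  have hLmul : ∀ (a b : G) (v : SabeH G), sabeL a (sabeL b v) = sabeL (a * b) v := fun a b v => by
    ext x; simp [mul_assoc]
  have hpow : ∀ q ∈ Q, ∀ i : ℕ, ∀ x, |F ((q ^ i)⁻¹ * x) - F x| ≤ i * β := by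
    intro q hq i
    induction i with
    | zero => intro x; simp
    | succ i ih =>
      intro x
      have a1 := hβ q hq ((q ^ i)⁻¹ * x)
      have a2 := ih x
      have a3 : (q ^ (i + 1))⁻¹ * x = q⁻¹ * ((q ^ i)⁻¹ * x) := by
        rw [pow_succ, mul_inv_rev, mul_assoc]
      rw [a3]
      have := abs_sub_le (F (q⁻¹ * ((q ^ i)⁻¹ * x))) (F ((q ^ i)⁻¹ * x)) (F x)
      push_cast
      linarith
  have hqE : ∀ q ∈ Q, ∀ v ∈ E, ‖sabeL q v - v‖ ≤ 8 * β / l * ‖v‖ := by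
    intro q hq v hv
    have := sabe_abs K (fun i => sabeL (q ^ i)) r hr (fun i v => sabeL_norm _ _)
      (fun v => by simp only [pow_zero]; exact hLone v)
      (fun i v => by simp only [hLmul, pow_one]; rw [← pow_succ])
      (fun v => by simp only [hQr q hq]; exact hLone v) (2 * β) (r * β + Ω.card * ε) l (by positivity)
      hl hη (by positivity) ?_ ?_ E hE1 v hv
    · simp only [pow_one] at this
      refine this.trans (le_of_eq ?_); ring
    · intro v
      simp only [pow_one]
      exact (sabe_ops S ψ h0 h1 hψ hψS Ω F hF hΩ q β hβ0 (hβ q hq) v).1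
    · intro i hi v
      have a1 := (sabe_ops S ψ h0 h1 hψ hψS Ω F hF hΩ (q ^ i) (i * β) (by positivity)
        (hpow q hq i) v).2 ε hε (hψε q hq i hi)
      refine a1.trans ?_
      have : (i : ℝ) ≤ r := by exact_mod_cast hi.le
      gcongr
  have hgE : ∀ m : ℕ, ∀ g ∈ Q ^ m, ∀ v ∈ E, ‖sabeL g v - v‖ ≤ m * (8 * β / l) * ‖v‖ := by
    intro m
    induction m with
    | zero => intro g hg v _; simp at hg; subst hg; simp [hLone]
    | succ m ih =>
      intro g hg v hv
      rw [pow_succ] at hg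
      obtain ⟨a, ha, q, hq, rfl⟩ := Finset.mem_mul.1 hg
      have : sabeL (a * q) v - v = sabeL a (sabeL q v - v) + (sabeL a v - v) := by
        rw [map_sub, hLmul]; abel
      rw [this]
      refine (norm_add_le _ _).trans ?_
      rw [sabeL_norm]
      have a1 := ih a ha v hv
      have a2 := hqE q hq v hv
      push_cast
      linarith
  obtain ⟨f1, hf1, hf2, hf3⟩ := hE2 f hf
  simp only [hKe]
  have e : sabeL g (K f) - K f = sabeL g (K f - K f1) + (sabeL g (K f1) - K f1) - (K f - K f1) := by
    rw [map_sub]; abel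
  rw [e]
  refine (norm_sub_le _ _).trans ?_
  have b1 := norm_add_le (sabeL g (K f - K f1)) (sabeL g (K f1) - K f1)
  rw [sabeL_norm] at b1
  have b2 := hgE m g hg _ hf1
  have b3 : m * (8 * β / l) * ‖K f1‖ ≤ m * (8 * β / l) * ‖f‖ := by
    have := (hKn f1).trans hf2
    gcongr
  linarith

set_option maxHeartbeats 2000000 in
theorem sabe_step {G : Type} [Group G] [DecidableEq G] (D Y Q : Finset G) (hD1 : 1 ∈ D)
    (hDi : D⁻¹ = D) (hYD : Y ⊆ D) (hY : Y.Nonempty) (C δ : ℝ) (hC1 : 1 ≤ C)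
    (hC : ((D ^ 17).card : ℝ) ≤ C * Y.card) (hQ1 : 1 ∈ Q) (hQi : Q⁻¹ = Q) (hQD : Q ⊆ D ^ 10)
    (r : ℕ) (hr : 0 < r) (hQr : ∀ q ∈ Q, q ^ r = 1)
    (hd : ∀ q ∈ Q, ∀ y ∈ D ^ 17, (sabeD Y (y⁻¹ * q * y) : ℝ) ≤ δ * Y.card)
    (hδ0 : 0 ≤ δ) (hδ : 1024 * C ^ 3 * r ^ 2 * δ ≤ 1) (n : ℕ) (hn : Q ^ (n + 1) ⊆ D ^ 10) :
    Q ^ (n + 2) ⊆ D ^ 10 := by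
  intro g hg
  by_contra hgD
  have hYp : (0 : ℝ) < Y.card := by exact_mod_cast hY.card_pos
  have hr1 : (1 : ℝ) ≤ r := by exact_mod_cast hr
  have hmono : ∀ a b : ℕ, a ≤ b → D ^ a ⊆ D ^ b := fun a b h => Finset.pow_subset_pow_right hD1 h
  have hDpi : ∀ a : ℕ, (D ^ a)⁻¹ = D ^ a := fun a => by rw [← inv_pow, hDi]
  have hmm : ∀ (a b : ℕ) (x y : G), x ∈ D ^ a → y ∈ D ^ b → x * y ∈ D ^ (a + b) :=
    fun a b x y hx hy => by rw [pow_add]; exact Finset.mul_mem_mul hx hy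
  have hinv : ∀ (a : ℕ) (x : G), x ∈ D ^ a → x⁻¹ ∈ D ^ a := fun a x hx => by
    rw [← hDpi]; exact Finset.inv_mem_inv hx
  set φ := sabePhi Q (D ^ 5) (n + 1) with hφ
  set S := D ^ 2 with hS
  set ψ := sabePsi Y with hψ
  have hYS : Y * Y⁻¹ ⊆ S := by
    rw [hS, pow_two]; exact Finset.mul_subset_mul hYD (by rw [← hDi]; exact Finset.inv_subset_inv hYD)
  have hψS : ∀ x ∉ S, ψ x = 0 := fun x hx => by
    by_contra h
    exact hx (hYS (sabePsi_supp Y x h))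
  have hψ1 := sabePsi_sum Y S hY hYS
  have hψ0 := sabePsi_nonneg Y
  set F : G → ℝ := fun x => ∑ s ∈ S, ψ s * φ (x * s) with hFdef
  have hφ0 : ∀ x, 0 ≤ φ x := fun x => (sabePhi_bd _ _ _ x).1
  have hφ1 : ∀ x, φ x ≤ 1 := fun x => (sabePhi_bd _ _ _ x).2
  have hφs : ∀ x ∉ D ^ 15, φ x = 0 := fun x hx => by
    by_contra h
    apply hx
    have := sabePhi_supp Q (D ^ 5) hQ1 n x h
    obtain ⟨a, ha, b, hb, rfl⟩ := Finset.mem_mul.1 this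
    exact hmm 10 5 a b (hn (Finset.pow_subset_pow_right hQ1 (by omega) ha)) hb
  have hF0 : ∀ x, 0 ≤ F x := fun x => Finset.sum_nonneg fun s _ => mul_nonneg (hψ0 s) (hφ0 _)
  have hF1 : ∀ x, F x ≤ 1 := fun x => by
    rw [← hψ1]
    refine Finset.sum_le_sum fun s _ => ?_
    have := mul_le_mul_of_nonneg_left (hφ1 (x * s)) (hψ0 s)
    simpa using this
  have hF : ∀ x, |F x| ≤ 1 := fun x => by rw [abs_of_nonneg (hF0 x)]; exact hF1 x
  have hFone : ∀ x ∈ D ^ 3, F x = 1 := fun x hx => by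
    rw [← hψ1]
    refine Finset.sum_congr rfl fun s hs => ?_
    rw [hφ, sabePhi_one Q (D ^ 5) hQ1 _ (by omega) _ (hmm 3 2 x s hx hs), mul_one]
  have hΩ : ∀ x ∉ D ^ 17, F x = 0 := fun x hx => by
    refine Finset.sum_eq_zero fun s hs => ?_
    rw [hφs, mul_zero]
    intro h
    apply hx
    have := hmm 15 2 _ _ h (hinv 2 s hs)
    simpa using this
  have hc15 : ((D ^ 15).card : ℝ) ≤ C * Y.card :=
    le_trans (by exact_mod_cast Finset.card_le_card (hmono 15 17 (by norm_num))) hC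
  set β : ℝ := C * r * δ / (n + 1) with hβdef
  have hβ0 : 0 ≤ β := by positivity
  have hβ : ∀ q ∈ Q, ∀ x, |F (q⁻¹ * x) - F x| ≤ β := by
    intro q hq x
    have := sabe_Flip Y S (D ^ 15) hY hYS φ q r hr (hQr q hq) ?_ (1 / ((n + 1 : ℕ) : ℝ)) δ
      (by positivity) (fun y => sabePhi_lip Q (D ^ 5) hQi (n + 1) (by omega) q hq y)
      (fun y hy => hd q hq y (hmono 15 17 (by norm_num) hy)) x
    · refine this.trans ?_
      have : ((D ^ 15).card : ℝ) * (1 / ((n + 1 : ℕ) : ℝ) * (r * δ / Y.card)) ≤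
        (C * Y.card) * (1 / ((n + 1 : ℕ) : ℝ) * (r * δ / Y.card)) := by gcongr
      refine this.trans (le_of_eq ?_)
      rw [hβdef]
      push_cast
      field_simp
    · intro y hy
      rw [hφs y hy, sub_zero]
      by_contra h
      apply hy
      have h2 := sabePhi_supp Q (D ^ 5) hQ1 n _ h
      obtain ⟨a, ha, b, hb, hab⟩ := Finset.mem_mul.1 h2
      have : y = (q * a) * b := by rw [mul_assoc, hab]; simp
      rw [this]
      refine hmm 10 5 _ b (hn ?_) hb
      rw [pow_succ']
      exact Finset.mul_mem_mul hq ha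
  have hf0 : Memℓp (fun x : G => if x ∈ D ^ 3 then (1 : ℝ) else 0) 2 := by
    refine memℓp_gen ?_
    refine summable_of_ne_finset_zero (s := D ^ 3) fun x hx => ?_
    simp [hx]
  set f : SabeH G := ⟨_, hf0⟩ with hfdef
  have hfx : ∀ x, f x = if x ∈ D ^ 3 then (1 : ℝ) else 0 := fun x => rfl
  have hfW : f ∈ sabeW (D ^ 17) := by
    intro x hx
    rw [hfx, if_neg (fun h => hx (hmono 3 17 (by norm_num) h))]
  set l : ℝ := 1 / (8 * C) with hldef
  have hl : 0 < l := by positivity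
  have key := sabe_op S ψ hψ0 hψ1 (fun s hs => hinv 2 s hs) (sabePsi_inv Y) hψS (D ^ 17) F hF hΩ Q r
    hr hQr β (r * δ / Y.card) l hβ0 (by positivity) hl hβ
    (fun q hq i hi y hy z => sabePsi_conj Y hY q y δ r i hi.le (hd q hq y hy) z) ?_ (n + 2) g hg f hfW
  · set k := sabeMul F 1 hF (sabeT S ψ (sabeMul F 1 hF f)) with hk
    have hkx : ∀ x, k x = F x * ∑ s ∈ S, ψ s * (F (x * s) * f (x * s)) := fun x => by
      rw [hk, sabeMul_apply, sabeT_apply]; rfl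
    have hk1 : ∀ x ∈ D, k x = 1 := by
      intro x hx
      rw [← pow_one D] at hx
      rw [hkx, hFone x (hmono 1 3 (by norm_num) hx), one_mul, ← hψ1]
      refine Finset.sum_congr rfl fun s hs => ?_
      have := hmm 1 2 x s hx hs
      rw [hFone _ this, hfx, if_pos this, mul_one, mul_one]
    have hk0 : ∀ x ∉ D ^ 5, k x = 0 := by
      intro x hx
      rw [hkx, Finset.sum_eq_zero, mul_zero]
      intro s hs
      rw [hfx, if_neg, mul_zero, mul_zero]
      intro h
      have := hmm 3 2 _ _ h (hinv 2 s hs)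
      apply hx
      simpa using this
    have hlow : (D.card : ℝ) ≤ ‖sabeL g k - k‖ ^ 2 := by
      refine le_trans (le_of_eq ?_) (sabe_sum_le (sabeL g k - k) D)
      rw [Finset.sum_eq_card_nsmul (b := (1 : ℝ))]
      · simp
      · intro x hx
        have : k (g⁻¹ * x) = 0 := by
          apply hk0
          intro h
          apply hgD
          have h2 := hmm 1 5 x _ (by rwa [pow_one]) (hinv 5 _ h)
          have : g = x * (g⁻¹ * x)⁻¹ := by simp
          rw [this]
          exact hmono 6 10 (by norm_num) h2
        rw [lp.coeFn_sub, Pi.sub_apply, sabeL_apply, this, hk1 x hx]; norm_num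
    have hfn : ‖f‖ ^ 2 = ((D ^ 3).card : ℝ) := by
      rw [sabe_norm_eq f (D ^ 3) (fun x hx => by rw [hfx, if_neg hx]),
        Finset.sum_eq_card_nsmul (b := (1 : ℝ))]
      · simp
      · intro x hx; rw [hfx, if_pos hx]; norm_num
    have hYDc : (Y.card : ℝ) ≤ D.card := by exact_mod_cast Finset.card_le_card hYD
    have hfn2 : ‖f‖ ^ 2 ≤ C * D.card := by
      rw [hfn]
      calc ((D ^ 3).card : ℝ) ≤ (D ^ 17).card := by
            exact_mod_cast Finset.card_le_card (hmono 3 17 (by norm_num))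
        _ ≤ C * Y.card := hC
        _ ≤ _ := by gcongr
    have hcoef : ((n + 2 : ℕ) : ℝ) * (8 * β / l) + 2 * l ≤ 1 / (2 * C) := by
      have h1 : ((n + 2 : ℕ) : ℝ) * (8 * β / l) ≤ 128 * C ^ 2 * r * δ := by
        have : ((n + 2 : ℕ) : ℝ) ≤ 2 * (n + 1) := by push_cast; linarith
        calc _ ≤ (2 * (n + 1)) * (8 * β / l) := by gcongr
          _ = _ := by rw [hβdef, hldef]; field_simp; ring
      have h2 : 128 * C ^ 2 * r * δ ≤ 1 / (8 * C) := by
        rw [le_div_iff₀ (by positivity)]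
        have : C ^ 3 * r * δ ≤ C ^ 3 * r ^ 2 * δ := by
          have : (r : ℝ) ≤ r ^ 2 := by nlinarith
          gcongr
        nlinarith
      have h3 : 2 * l = 2 / (8 * C) := by rw [hldef]; ring
      have h4 : 1 / (2 * C) = 4 / (8 * C) := by field_simp; norm_num
      rw [h3, h4]
      have : 4 / (8 * C) = 1 / (8 * C) + 2 / (8 * C) + 1 / (8 * C) := by ring
      have : 0 < 1 / (8 * C) := hl
      linarith
    have hup : ‖sabeL g k - k‖ ≤ 1 / (2 * C) * ‖f‖ := key.trans (by gcongr)
    have hup2 : ‖sabeL g k - k‖ ^ 2 ≤ (1 / (2 * C) * ‖f‖) ^ 2 := by gcongr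
    rw [mul_pow] at hup2
    have h5 : (1 / (2 * C)) ^ 2 * ‖f‖ ^ 2 ≤ (1 / (2 * C)) ^ 2 * (C * D.card) := by gcongr
    have h6 : (1 / (2 * C)) ^ 2 * (C * D.card) = D.card / (4 * C) := by field_simp; ring
    have h7 : (D.card : ℝ) / (4 * C) < D.card := by
      apply div_lt_self (by linarith) (by linarith)
    linarith
  · have h1 : (r : ℝ) * β ≤ C * r ^ 2 * δ := by
      rw [hβdef, ← mul_div_assoc]
      refine (div_le_self (by positivity) (by linarith [Nat.cast_nonneg (α := ℝ) n])).trans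
        (le_of_eq (by ring))
    have h2 : ((D ^ 17).card : ℝ) * (r * δ / Y.card) ≤ C * r ^ 2 * δ := by
      calc _ ≤ (C * Y.card) * (r * δ / Y.card) := by gcongr
        _ = C * (r : ℝ) * δ := by field_simp
        _ ≤ _ := by
          have : (r : ℝ) ≤ r ^ 2 := by nlinarith
          gcongr
    have h3 : l / 2 = 1 / (16 * C) := by rw [hldef]; field_simp; norm_num
    have h4 : 2 * (C * r ^ 2 * δ) ≤ 1 / (16 * C) := by
      rw [le_div_iff₀ (by positivity)]
      have : C ^ 2 * r ^ 2 * δ ≤ C ^ 3 * r ^ 2 * δ := by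
        have : C ^ 2 ≤ C ^ 3 := pow_le_pow_right₀ hC1 (by norm_num)
        gcongr
      nlinarith
    linarith

theorem sabe_iter {G : Type} [Group G] [DecidableEq G] (D Y Q : Finset G) (hD1 : 1 ∈ D)
    (hDi : D⁻¹ = D) (hYD : Y ⊆ D) (hY : Y.Nonempty) (C δ : ℝ) (hC1 : 1 ≤ C)
    (hC : ((D ^ 17).card : ℝ) ≤ C * Y.card) (hQ1 : 1 ∈ Q) (hQi : Q⁻¹ = Q) (hQD : Q ⊆ D ^ 10)
    (r : ℕ) (hr : 0 < r) (hQr : ∀ q ∈ Q, q ^ r = 1)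
    (hd : ∀ q ∈ Q, ∀ y ∈ D ^ 17, (sabeD Y (y⁻¹ * q * y) : ℝ) ≤ δ * Y.card)
    (hδ0 : 0 ≤ δ) (hδ : 1024 * C ^ 3 * r ^ 2 * δ ≤ 1) :
    (Subgroup.closure (Q : Set G) : Set G) ⊆ ↑(D ^ 10) := by
  have h : ∀ n, Q ^ (n + 1) ⊆ D ^ 10 := by
    intro n
    induction n with
    | zero => simpa using hQD
    | succ n ih =>
      exact sabe_step D Y Q hD1 hDi hYD hY C δ hC1 hC hQ1 hQi hQD r hr hQr hd hδ0 hδ n ih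
  intro x hx
  have hx' : x ∈ Subgroup.closure (Q : Set G) := hx
  clear hx
  obtain ⟨n, hn⟩ : ∃ n : ℕ, x ∈ Q ^ n := by
    induction hx' using Subgroup.closure_induction with
    | mem x hx => exact ⟨1, by simpa using hx⟩
    | one => exact ⟨0, by simp⟩
    | mul x y hx hy ihx ihy =>
      obtain ⟨a, ha⟩ := ihx
      obtain ⟨b, hb⟩ := ihy
      exact ⟨a + b, by rw [pow_add]; exact Finset.mul_mem_mul ha hb⟩
    | inv x hx ih =>
      obtain ⟨a, ha⟩ := ih
      exact ⟨a, by rw [← hQi, inv_pow]; exact Finset.inv_mem_inv ha⟩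
  exact h n (Finset.pow_subset_pow_right hQ1 (by omega) hn)

theorem sabe_ruzsa {G : Type} [Group G] [DecidableEq G] (X Y Z : Finset G) :
    (X * Z).card * Y.card ≤ (X * Y⁻¹).card * (Y * Z).card := by
  have := Finset.ruzsa_triangle_inequality_div_div_div X Y Z⁻¹
  have e : (Y * Z).card = (Z⁻¹ * Y⁻¹).card := by rw [← mul_inv_rev, Finset.card_inv]
  rw [e]
  simpa [div_eq_mul_inv] using this

theorem sabe_ruzsaR {G : Type} [Group G] [DecidableEq G] (X Y Z A : Finset G) (hA : A.Nonempty)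
    (hY : Y.card = A.card) (a b : ℝ) (ha : 0 ≤ a) (h1 : ((X * Y⁻¹).card : ℝ) ≤ a * A.card)
    (h2 : ((Y * Z).card : ℝ) ≤ b * A.card) : ((X * Z).card : ℝ) ≤ a * b * A.card := by
  have h := sabe_ruzsa X Y Z
  rw [hY] at h
  have hAp : (0 : ℝ) < A.card := by exact_mod_cast hA.card_pos
  have h' : ((X * Z).card : ℝ) * A.card ≤ (X * Y⁻¹).card * (Y * Z).card := by exact_mod_cast h
  refine le_of_mul_le_mul_right ?_ hAp
  calc _ ≤ _ := h'
    _ ≤ (a * A.card) * (b * A.card) := by gcongr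
    _ = _ := by ring

theorem sabe_trip {G : Type} [Group G] [DecidableEq G] (A : Finset G) (hA : A.Nonempty) (k : ℝ)
    (hk : 1 ≤ k) (h : ((A * A⁻¹ * A).card : ℝ) ≤ k * A.card) (m : ℕ) :
    (((A * A⁻¹) ^ m).card : ℝ) ≤ (k ^ 4) ^ (m + 1) * k * A.card := by
  have hi : (A⁻¹).card = A.card := Finset.card_inv A
  have hT : ((A⁻¹ * A * A⁻¹).card : ℝ) ≤ k * A.card := by
    rw [← Finset.card_inv]; simpa [mul_inv_rev, mul_assoc] using h
  have hk0 : 0 ≤ k := by linarith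
  have h1 : (((A⁻¹ * A) * (A⁻¹ * A)).card : ℝ) ≤ k * k * A.card :=
    sabe_ruzsaR _ A _ A hA rfl k k hk0 hT (by simpa [mul_assoc] using h)
  have h2 : (((A * A⁻¹) * (A * A⁻¹ * A)).card : ℝ) ≤ k * (k * k) * A.card :=
    sabe_ruzsaR _ A⁻¹ _ A hA hi k (k * k) hk0 (by simpa using h) (by simpa [mul_assoc] using h1)
  have h2' : ((A⁻¹ * ((A * A⁻¹) * (A * A⁻¹))).card : ℝ) ≤ k * (k * k) * A.card := by
    rw [← Finset.card_inv]; simpa [mul_inv_rev, mul_assoc] using h2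
  have h3 : (((A * A⁻¹) * ((A * A⁻¹) * (A * A⁻¹))).card : ℝ) ≤ k * (k * (k * k)) * A.card :=
    sabe_ruzsaR _ A⁻¹ _ A hA hi k _ hk0 (by simpa using h) h2'
  set D := A * A⁻¹ with hD
  have hAD : A.card ≤ D.card := Finset.card_le_card_mul_right hA.inv
  have hAD' : (A.card : ℝ) ≤ D.card := by exact_mod_cast hAD
  have hDA : (D.card : ℝ) ≤ k * A.card :=
    le_trans (by exact_mod_cast Finset.card_le_card_mul_right hA) h
  have h4 : ((D ^ 3).card : ℝ) ≤ k ^ 4 * D.card := by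
    have : D ^ 3 = D * (D * D) := by rw [pow_succ', pow_two]
    rw [this]
    refine h3.trans ?_
    have : k * (k * (k * k)) = k ^ 4 := by ring
    rw [this]; gcongr
  have h5 := Finset.small_pow_of_small_tripling (m := m + 3) (by omega) h4 (by rw [hD]; simp)
  have hD1 : 1 ∈ D := by
    obtain ⟨a, ha⟩ := hA
    exact Finset.mem_mul.2 ⟨a, ha, a⁻¹, Finset.inv_mem_inv ha, by simp⟩
  calc ((D ^ m).card : ℝ) ≤ (D ^ (m + 3)).card := by
        exact_mod_cast Finset.card_le_card (Finset.pow_subset_pow_right hD1 (by omega))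
    _ ≤ (k ^ 4) ^ (m + 1) * D.card := h5
    _ ≤ (k ^ 4) ^ (m + 1) * (k * A.card) := by gcongr
    _ = _ := by ring

theorem sabe_sand_aux (k δ : ℝ) (hk : 1 ≤ k) (hδ1 : δ < 1) (L : ℕ) :
    ∀ t : ℝ, 0 < t → ∃ c : ℝ, 0 < c ∧ ∀ (G : Type) [Group G] [DecidableEq G] (A : Finset G),
      A.Nonempty → ((A * A⁻¹).card : ℝ) ≤ k * A.card → ∀ B ⊆ A, t * A.card ≤ B.card →
      (1 - δ) ^ L * ((B * A⁻¹).card : ℝ) < A.card →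
      ∃ Y X : Finset G, Y ⊆ A * A⁻¹ ∧ A.card ≤ Y.card ∧ X ⊆ A * A⁻¹ ∧ c * A.card ≤ X.card ∧
        ∀ x ∈ X, (sabeD Y x : ℝ) ≤ δ * Y.card := by
  induction L with
  | zero =>
    intro t ht
    refine ⟨1, one_pos, ?_⟩
    intro G _ _ A hA hAk B hBA hB hlt
    exfalso
    have hAp : (0 : ℝ) < A.card := by exact_mod_cast hA.card_pos
    have hBp : (0 : ℝ) < B.card := lt_of_lt_of_le (by positivity) hB
    have hBn : B.Nonempty := Finset.card_pos.1 (by exact_mod_cast hBp)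
    have h1 : A⁻¹.card ≤ (B * A⁻¹).card := Finset.card_le_card_mul_left hBn
    rw [Finset.card_inv] at h1
    have h2 : (A.card : ℝ) ≤ (B * A⁻¹).card := by exact_mod_cast h1
    simp at hlt
    have h3 : ((B * A⁻¹).card : ℝ) < A.card := by exact_mod_cast hlt
    linarith
  | succ L ih =>
    intro t ht
    obtain ⟨c, hc, hcc⟩ := ih (t ^ 2 / (2 * k)) (by positivity)
    refine ⟨min c (t ^ 2 / 2), lt_min hc (by positivity), ?_⟩
    intro G _ _ A hA hAk B hBA hB hlt
    have hAp : (0 : ℝ) < A.card := by exact_mod_cast hA.card_pos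
    have hBp : (0 : ℝ) < B.card := lt_of_lt_of_le (by positivity) hB
    have hBn : B.Nonempty := Finset.card_pos.1 (by exact_mod_cast hBp)
    set X := (A * A⁻¹).filter (fun x => t ^ 2 / (2 * k) * A.card ≤ ((B ∩ x • B).card : ℝ)) with hX
    have hXc : t ^ 2 / 2 * A.card ≤ X.card := by
      have h1 := sabe_sum_inter B (A * A⁻¹)
        (Finset.mul_subset_mul hBA (Finset.inv_subset_inv hBA))
      have h2 : ∑ x ∈ A * A⁻¹, ((B ∩ x • B).card : ℝ) = (B.card : ℝ) ^ 2 := by exact_mod_cast h1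
      rw [← Finset.sum_filter_add_sum_filter_not (A * A⁻¹)
        (fun x => t ^ 2 / (2 * k) * A.card ≤ ((B ∩ x • B).card : ℝ))] at h2
      have h3 : ∑ x ∈ X, ((B ∩ x • B).card : ℝ) ≤ X.card * A.card := by
        rw [← nsmul_eq_mul]
        refine Finset.sum_le_card_nsmul _ _ _ fun x _ => ?_
        exact_mod_cast Finset.card_le_card (Finset.inter_subset_left.trans hBA)
      have h4 : ∑ x ∈ (A * A⁻¹).filter
          (fun x => ¬ t ^ 2 / (2 * k) * A.card ≤ ((B ∩ x • B).card : ℝ)), ((B ∩ x • B).card : ℝ) ≤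
          (k * A.card) * (t ^ 2 / (2 * k) * A.card) := by
        refine (Finset.sum_le_card_nsmul _ _ (t ^ 2 / (2 * k) * A.card) fun x hx => ?_).trans ?_
        · exact (not_le.1 (Finset.mem_filter.1 hx).2).le
        · rw [nsmul_eq_mul]
          gcongr
          exact le_trans (by exact_mod_cast Finset.card_filter_le _ _) hAk
      have h5 : (k * A.card) * (t ^ 2 / (2 * k) * A.card) = t ^ 2 / 2 * A.card * A.card := by
        field_simp
      have h6 : (t * A.card) ^ 2 ≤ (B.card : ℝ) ^ 2 := by gcongr
      rw [← hX] at h2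
      refine le_of_mul_le_mul_right ?_ hAp
      nlinarith
    by_cases hall : ∀ x ∈ X, (1 - δ) * ((B * A⁻¹).card : ℝ) ≤ ((B ∩ x • B) * A⁻¹).card
    · refine ⟨B * A⁻¹, X, Finset.mul_subset_mul_right hBA, ?_, Finset.filter_subset _ _, ?_, ?_⟩
      · rw [← Finset.card_inv A]; exact Finset.card_le_card_mul_left hBn
      · refine le_trans ?_ hXc
        gcongr
        exact min_le_right _ _
      · intro x hx
        have h1 := hall x hx
        have h2 : (B ∩ x • B) * A⁻¹ ⊆ x • (B * A⁻¹) ∩ (B * A⁻¹) := by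
          refine Finset.subset_inter ?_ (Finset.mul_subset_mul_right Finset.inter_subset_left)
          rw [← smul_mul_assoc]
          exact Finset.mul_subset_mul_right Finset.inter_subset_right
        have h3 := Finset.card_le_card h2
        have h4 := Finset.card_sdiff_add_card_inter (x • (B * A⁻¹)) (B * A⁻¹)
        rw [Finset.card_smul_finset] at h4
        have h3' : (((B ∩ x • B) * A⁻¹).card : ℝ) ≤ (x • (B * A⁻¹) ∩ (B * A⁻¹)).card := by
          exact_mod_cast h3
        have h4' : (sabeD (B * A⁻¹) x : ℝ) + (x • (B * A⁻¹) ∩ (B * A⁻¹)).card = (B * A⁻¹).card := by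
          unfold sabeD; exact_mod_cast h4
        linarith
    · push Not at hall
      obtain ⟨x, hx, hxlt⟩ := hall
      obtain ⟨Y, X', h1, h2, h3, h4, h5⟩ := hcc G A hA hAk (B ∩ x • B)
        (Finset.inter_subset_left.trans hBA) (Finset.mem_filter.1 hx).2 (by
          refine lt_of_le_of_lt ?_ hlt
          rw [pow_succ, mul_assoc]
          have : 0 ≤ 1 - δ := by linarith
          gcongr)
      refine ⟨Y, X', h1, h2, h3, le_trans ?_ h4, h5⟩
      gcongr
      exact min_le_left _ _

theorem sabe_sand (k δ : ℝ) (hk : 1 ≤ k) (hδ0 : 0 < δ) (hδ1 : δ < 1) :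
    ∃ c : ℝ, 0 < c ∧ ∀ (G : Type) [Group G] [DecidableEq G] (A : Finset G),
      A.Nonempty → ((A * A⁻¹).card : ℝ) ≤ k * A.card →
      ∃ Y X : Finset G, Y ⊆ A * A⁻¹ ∧ A.card ≤ Y.card ∧ X ⊆ A * A⁻¹ ∧ c * A.card ≤ X.card ∧
        ∀ x ∈ X, (sabeD Y x : ℝ) ≤ δ * Y.card := by
  obtain ⟨L, hL⟩ := exists_pow_lt_of_lt_one (x := 1 / k) (y := 1 - δ) (by positivity) (by linarith)
  obtain ⟨c, hc, h⟩ := sabe_sand_aux k δ hk hδ1 L 1 one_pos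
  refine ⟨c, hc, ?_⟩
  intro G _ _ A hA hAk
  have hAp : (0 : ℝ) < A.card := by exact_mod_cast hA.card_pos
  refine h G A hA hAk A subset_rfl (by simp) ?_
  have h0 : 0 ≤ (1 - δ) ^ L := pow_nonneg (by linarith) _
  calc (1 - δ) ^ L * ((A * A⁻¹).card : ℝ) ≤ (1 - δ) ^ L * (k * A.card) := by gcongr
    _ < 1 / k * (k * A.card) := by gcongr
    _ = _ := by field_simp

theorem sabe_conj {G : Type} [Group G] [DecidableEq G] (D X : Finset G) (hD1 : 1 ∈ D)
    (hDi : D⁻¹ = D) (hX : X ⊆ D) (θ : ℝ) (hθ0 : 0 < θ)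
    (hθ : θ * ((D ^ 19).card : ℝ) ≤ X.card) (F : Finset G) (hF : F ⊆ D ^ 17) :
    ∃ E ⊆ D, θ ^ F.card * D.card ≤ E.card ∧
      ∀ x ∈ F, ∀ e ∈ E, ∀ e' ∈ E, x⁻¹ * (e * e'⁻¹) * x ∈ X * X⁻¹ := by
  induction F using Finset.induction_on with
  | empty => exact ⟨D, subset_rfl, by simp, by simp⟩
  | insert x F hx ih =>
    obtain ⟨E, hED, hEc, hE⟩ := ih ((Finset.subset_insert _ _).trans hF)
    have hxD : x ∈ D ^ 17 := hF (Finset.mem_insert_self _ _)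
    have hinv : ∀ (a : ℕ) (y : G), y ∈ D ^ a → y⁻¹ ∈ D ^ a := fun a y hy => by
      rw [← hDi, inv_pow]; exact Finset.inv_mem_inv hy
    have hmaps : ∀ p ∈ E ×ˢ X, p.2⁻¹ * x⁻¹ * p.1 ∈ D ^ 19 := by
      rintro ⟨e, y⟩ hp
      rw [Finset.mem_product] at hp
      have h1 : y⁻¹ ∈ D ^ 1 := hinv 1 y (by rw [pow_one]; exact hX hp.2)
      have h2 := hinv 17 x hxD
      have h3 : e ∈ D ^ 1 := by rw [pow_one]; exact hED hp.1
      have : D ^ 19 = D ^ 1 * D ^ 17 * D ^ 1 := by rw [← pow_add, ← pow_add]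
      rw [this]
      exact Finset.mul_mem_mul (Finset.mul_mem_mul h1 h2) h3
    obtain ⟨t, ht, hcard⟩ := Finset.exists_le_card_fiber_of_nsmul_le_card_of_maps_to
      (s := E ×ˢ X) (t := D ^ 19) (f := fun p => p.2⁻¹ * x⁻¹ * p.1) (b := θ * (E.card : ℝ)) hmaps
      ⟨1, Finset.one_mem_pow hD1⟩ (by
        rw [nsmul_eq_mul, Finset.card_product]
        push_cast
        calc _ = E.card * (θ * ((D ^ 19).card : ℝ)) := by ring
          _ ≤ _ := by gcongr)
    refine ⟨E.filter (fun e => ∃ y ∈ X, y⁻¹ * x⁻¹ * e = t), (Finset.filter_subset _ _).trans hED,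
      ?_, ?_⟩
    · rw [Finset.card_insert_of_notMem hx, pow_succ]
      calc _ = θ * (θ ^ F.card * D.card) := by ring
        _ ≤ θ * E.card := by gcongr
        _ ≤ _ := hcard
        _ ≤ _ := by
          norm_cast
          refine Finset.card_le_card_of_injOn (fun p => p.1) ?_ ?_
          · rintro ⟨e, y⟩ hp
            simp only [Finset.coe_filter, Finset.mem_product] at hp
            simp only [Finset.coe_filter]
            exact ⟨hp.1.1, y, hp.1.2, hp.2⟩
          · rintro ⟨e, y⟩ hp ⟨e', y'⟩ hp' h
            simp only [Finset.coe_filter, Finset.mem_product] at hp hp'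
            have h1 := hp.2.trans hp'.2.symm
            simp only at h h1
            subst h
            simpa using h1
    · intro z hz e he e' he'
      rw [Finset.mem_filter] at he he'
      rcases Finset.mem_insert.1 hz with rfl | hz
      · obtain ⟨he, y, hy, h⟩ := he
        obtain ⟨he', y', hy', h'⟩ := he'
        have e1 : e = z * y * t := by rw [← h]; group
        have e2 : e' = z * y' * t := by rw [← h']; group
        have : z⁻¹ * (e * e'⁻¹) * z = y * y'⁻¹ := by rw [e1, e2]; group
        rw [this]
        exact Finset.mul_mem_mul hy (Finset.inv_mem_inv hy')
      · exact hE z hz e he.1 e' he'.1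

theorem sabe_core (k : ℝ) (hk : 1 ≤ k) (r : ℕ) (hr : 0 < r) :
    ∃ c : ℝ, 0 < c ∧ ∀ (G : Type) [Group G] [DecidableEq G] (A : Finset G), A.Nonempty →
      ((A * A⁻¹ * A).card : ℝ) ≤ k * A.card →
      (∀ x ∈ Subgroup.closure ((A * A⁻¹ : Finset G) : Set G), x ^ r = 1) →
      ∃ H : Subgroup G, H ≤ Subgroup.closure ((A * A⁻¹ : Finset G) : Set G) ∧
        (H : Set G) ⊆ ↑((A * A⁻¹) ^ 10) ∧ ∃ Q : Finset G, (Q : Set G) ⊆ H ∧ c * A.card ≤ Q.card := by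
  have hk0 : 0 < k := by linarith
  have hr1 : (1 : ℝ) ≤ r := by exact_mod_cast hr
  have hKp : ∀ m : ℕ, 1 ≤ (k ^ 4) ^ (m + 1) * k := fun m =>
    one_le_mul_of_one_le_of_one_le (one_le_pow₀ (one_le_pow₀ hk)) hk
  set C : ℝ := (k ^ 4) ^ (17 + 1) * k with hC
  have hC1 : 1 ≤ C := hKp 17
  set δ : ℝ := 1 / (1024 * C ^ 3 * r ^ 2) with hδ
  have hδ0 : 0 < δ := by positivity
  have hden : 1 ≤ 1024 * C ^ 3 * (r : ℝ) ^ 2 := by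
    have h1 : 1 ≤ C ^ 3 := one_le_pow₀ hC1
    have h2 : 1 ≤ (r : ℝ) ^ 2 := one_le_pow₀ hr1
    exact one_le_mul_of_one_le_of_one_le (by linarith) h2
  have hδ1 : δ ≤ 1 := by rw [hδ]; exact div_le_one_of_le₀ hden (by positivity)
  obtain ⟨c0, hc0, hs⟩ := sabe_sand k (δ / 6) hk (by positivity) (by linarith)
  set θ : ℝ := min 1 (c0 / ((k ^ 4) ^ (19 + 1) * k)) with hθ
  have hθ0 : 0 < θ := lt_min one_pos (by positivity)
  set N : ℕ := ⌈(k ^ 4) ^ (18 + 1) * k / c0⌉₊ with hN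
  refine ⟨θ ^ N, by positivity, ?_⟩
  intro G _ _ A hA hAk hexp
  have hAp : (0 : ℝ) < A.card := by exact_mod_cast hA.card_pos
  have hpow := sabe_trip A hA k hk hAk
  have hDA : ((A * A⁻¹).card : ℝ) ≤ k * A.card :=
    le_trans (by exact_mod_cast Finset.card_le_card_mul_right hA) hAk
  obtain ⟨Y, X, hYD, hAY, hXD, hXc, hXY⟩ := hs G A hA hDA
  set D := A * A⁻¹ with hD
  have hDi : D⁻¹ = D := by rw [hD]; simp
  have hD1 : 1 ∈ D := by
    obtain ⟨a, ha⟩ := hA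
    exact Finset.mem_mul.2 ⟨a, ha, a⁻¹, Finset.inv_mem_inv ha, by simp⟩
  have hXp : (0 : ℝ) < X.card := lt_of_lt_of_le (by positivity) hXc
  have hXn : X.Nonempty := Finset.card_pos.1 (by exact_mod_cast hXp)
  have hAY' : (A.card : ℝ) ≤ Y.card := by exact_mod_cast hAY
  have hYn : Y.Nonempty := Finset.card_pos.1 (lt_of_lt_of_le hA.card_pos hAY)
  obtain ⟨F, hFD, hFc, hF⟩ := Finset.ruzsa_covering_mul (A := D ^ 17) (B := X)
    (K := (k ^ 4) ^ (18 + 1) * k / c0) hXn (by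
      calc ((D ^ 17 * X).card : ℝ) ≤ (D ^ 18).card := by
            have : D ^ 17 * X ⊆ D ^ 18 := by
              rw [pow_succ D 17]; exact Finset.mul_subset_mul_left hXD
            exact_mod_cast Finset.card_le_card this
        _ ≤ (k ^ 4) ^ (18 + 1) * k * A.card := hpow 18
        _ = (k ^ 4) ^ (18 + 1) * k / c0 * (c0 * A.card) := by field_simp
        _ ≤ _ := by gcongr)
  have hFN : F.card ≤ N := by
    have : (F.card : ℝ) ≤ N := hFc.trans (Nat.le_ceil _)
    exact_mod_cast this
  obtain ⟨E, hED, hEc, hE⟩ := sabe_conj D X hD1 hDi hXD θ hθ0 (by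
      calc θ * ((D ^ 19).card : ℝ) ≤ c0 / ((k ^ 4) ^ (19 + 1) * k) *
            ((k ^ 4) ^ (19 + 1) * k * A.card) := by
            have := hpow 19
            gcongr
            exact min_le_right _ _
        _ = c0 * A.card := by field_simp
        _ ≤ _ := hXc) F hFD
  have hADc : (A.card : ℝ) ≤ D.card := by
    exact_mod_cast Finset.card_le_card_mul_right hA.inv
  have hEc2 : θ ^ N * A.card ≤ E.card := by
    refine le_trans ?_ hEc
    have : θ ^ N ≤ θ ^ F.card := pow_le_pow_of_le_one hθ0.le (min_le_left _ _) hFN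
    gcongr
  have hEp : (0 : ℝ) < E.card := lt_of_lt_of_le (by positivity) hEc2
  have hEn : E.Nonempty := Finset.card_pos.1 (by exact_mod_cast hEp)
  set Q := E * E⁻¹ with hQ
  have hQD2 : Q ⊆ D * D := Finset.mul_subset_mul hED (by
    rw [← hDi]; exact Finset.inv_subset_inv hED)
  have hQcl : (Q : Set G) ⊆ Subgroup.closure (D : Set G) := by
    intro q hq
    obtain ⟨a, ha, b, hb, rfl⟩ := Finset.mem_mul.1 (hQD2 hq)
    exact mul_mem (Subgroup.subset_closure ha) (Subgroup.subset_closure hb)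
  have hQ1 : 1 ∈ Q := by
    obtain ⟨a, ha⟩ := hEn
    exact Finset.mem_mul.2 ⟨a, ha, a⁻¹, Finset.inv_mem_inv ha, by simp⟩
  refine ⟨Subgroup.closure (Q : Set G), (Subgroup.closure_le _).2 hQcl, ?_, Q,
    Subgroup.subset_closure, ?_⟩
  · refine sabe_iter D Y Q hD1 hDi hYD hYn C δ hC1 ?_ hQ1 (by rw [hQ]; simp) ?_ r hr
      (fun q hq => hexp q (hQcl hq)) ?_ hδ0.le ?_
    · refine (hpow 17).trans ?_
      gcongr
    · rw [← pow_two] at hQD2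
      exact hQD2.trans (Finset.pow_subset_pow_right hD1 (by norm_num))
    · intro q hq y hy
      obtain ⟨x, hx, w, hw, rfl⟩ := Finset.mem_mul.1 (hF hy)
      obtain ⟨a, ha, b, hb, rfl⟩ := Finset.mem_div.1 hw
      obtain ⟨e, he, e', he', rfl⟩ := Finset.mem_mul.1 hq
      obtain ⟨e'', he'', rfl⟩ := Finset.mem_inv.1 he'
      obtain ⟨u, hu, v, hv, huv⟩ := Finset.mem_mul.1 (hE x hx e he e'' he'')
      obtain ⟨v', hv', rfl⟩ := Finset.mem_inv.1 hv
      have e1 : (x * (a / b))⁻¹ * (e * e''⁻¹) * (x * (a / b)) =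
          b * a⁻¹ * (u * v'⁻¹) * (a * b⁻¹) := by rw [huv, div_eq_mul_inv]; group
      rw [e1]
      have d1 := sabeD_mul Y (b * a⁻¹ * (u * v'⁻¹)) (a * b⁻¹)
      have d2 := sabeD_mul Y (b * a⁻¹) (u * v'⁻¹)
      have d3 := sabeD_mul Y b a⁻¹
      have d4 := sabeD_mul Y u v'⁻¹
      have d5 := sabeD_mul Y a b⁻¹
      rw [sabeD_inv] at d3 d4 d5
      have d6 : sabeD Y (b * a⁻¹ * (u * v'⁻¹) * (a * b⁻¹)) ≤
        sabeD Y b + sabeD Y a + (sabeD Y u + sabeD Y v') + (sabeD Y a + sabeD Y b) := by omega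
      have d7 : (sabeD Y (b * a⁻¹ * (u * v'⁻¹) * (a * b⁻¹)) : ℝ) ≤
        sabeD Y b + sabeD Y a + (sabeD Y u + sabeD Y v') + (sabeD Y a + sabeD Y b) := by
        exact_mod_cast d6
      have := hXY a ha
      have := hXY b hb
      have := hXY u hu
      have := hXY v' hv'
      linarith
    · rw [hδ, mul_one_div_cancel (by positivity)]
  · refine hEc2.trans ?_
    exact_mod_cast Finset.card_le_card_mul_right hEn.inv

theorem small_alternation_bounded_exponent (k m r : ℕ) (hk : 0 < k) (hm : 0 < m)
    (hr : 0 < r) :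
    ∃ C : ℕ, ∀ (G : Type) [Group G] [DecidableEq G],
      ∀ A : Finset G, A.Nonempty →
      (A * A⁻¹ * A).card ≤ k * A.card →
      (∀ x ∈ Subgroup.closure ((A * A⁻¹ : Finset G) : Set G), x ^ r = 1) →
      ∃ H : Subgroup G, H ≤ Subgroup.closure ((A * A⁻¹ : Finset G) : Set G) ∧
        (∃ F : Finset G, F.card ≤ C ∧
          (((A * A⁻¹) ^ m : Finset G) : Set G) ⊆ (F : Set G) * (H : Set G)) ∧
        (H : Set G) ⊆ ↑((A * A⁻¹) ^ 2) := by
  have hk1 : (1 : ℝ) ≤ k := by exact_mod_cast hk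
  obtain ⟨c1, hc1, hs⟩ := sabe_sand k (1 / 21) hk1 (by norm_num) (by norm_num)
  set k' : ℝ := max 1 (((k : ℝ) ^ 4) ^ (3 + 1) * k / c1) with hk'
  obtain ⟨c2, hc2, hcore⟩ := sabe_core k' (le_max_left _ _) r hr
  refine ⟨⌈((k : ℝ) ^ 4) ^ (m + 2 + 1) * k / (c2 * c1)⌉₊, ?_⟩
  intro G _ _ A hA hAk0 hexp
  have hAk : ((A * A⁻¹ * A).card : ℝ) ≤ k * A.card := by exact_mod_cast hAk0
  have hAp : (0 : ℝ) < A.card := by exact_mod_cast hA.card_pos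
  have hpow := sabe_trip A hA k hk1 hAk
  have hDA : ((A * A⁻¹).card : ℝ) ≤ k * A.card :=
    le_trans (by exact_mod_cast Finset.card_le_card_mul_right hA) hAk
  obtain ⟨Y, X, hYD, hAY, hXD, hXc, hXY⟩ := hs G A hA hDA
  set D := A * A⁻¹ with hD
  have hDi : D⁻¹ = D := by rw [hD]; simp
  have hXi : X⁻¹ ⊆ D := by rw [← hDi]; exact Finset.inv_subset_inv hXD
  have hXp : (0 : ℝ) < X.card := lt_of_lt_of_le (by positivity) hXc
  have hXn : X.Nonempty := Finset.card_pos.1 (by exact_mod_cast hXp)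
  have hYn : Y.Nonempty := Finset.card_pos.1 (lt_of_lt_of_le hA.card_pos hAY)
  have hYp : (0 : ℝ) < Y.card := by exact_mod_cast hYn.card_pos
  have hXcl : Subgroup.closure ((X * X⁻¹ : Finset G) : Set G) ≤ Subgroup.closure (D : Set G) := by
    refine (Subgroup.closure_le _).2 ?_
    intro q hq
    obtain ⟨a, ha, b, hb, rfl⟩ := Finset.mem_mul.1 (Finset.mem_coe.1 hq)
    exact mul_mem (Subgroup.subset_closure (hXD ha)) (Subgroup.subset_closure (hXi hb))
  obtain ⟨H, hHcl, hH10, Q, hQH, hQc⟩ := hcore G X hXn (by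
      have h3 : X * X⁻¹ * X ⊆ D ^ 3 := by
        rw [pow_succ, pow_two]
        exact Finset.mul_subset_mul (Finset.mul_subset_mul hXD hXi) hXD
      calc ((X * X⁻¹ * X).card : ℝ) ≤ (D ^ 3).card := by exact_mod_cast Finset.card_le_card h3
        _ ≤ ((k : ℝ) ^ 4) ^ (3 + 1) * k * A.card := hpow 3
        _ = ((k : ℝ) ^ 4) ^ (3 + 1) * k / c1 * (c1 * A.card) := by field_simp
        _ ≤ k' * X.card := by
          gcongr
          exact le_max_right _ _) (fun x hx => hexp x (hXcl hx))
  have hpw : ∀ n : ℕ, ∀ x ∈ (X * X⁻¹) ^ n, (sabeD Y x : ℝ) ≤ n * (2 / 21 * Y.card) := by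
    intro n
    induction n with
    | zero => intro x hx; simp at hx; subst hx; simp [sabeD]
    | succ n ih =>
      intro x hx
      rw [pow_succ] at hx
      obtain ⟨a, ha, b, hb, rfl⟩ := Finset.mem_mul.1 hx
      obtain ⟨u, hu, v, hv, rfl⟩ := Finset.mem_mul.1 hb
      obtain ⟨v', hv', rfl⟩ := Finset.mem_inv.1 hv
      have d1 := sabeD_mul Y a (u * v'⁻¹)
      have d2 := sabeD_mul Y u v'⁻¹
      rw [sabeD_inv] at d2
      have d3 : (sabeD Y (a * (u * v'⁻¹)) : ℝ) ≤ sabeD Y a + (sabeD Y u + sabeD Y v') := by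
        exact_mod_cast d1.trans (by omega)
      have := ih a ha
      have := hXY u hu
      have := hXY v' hv'
      push_cast
      linarith
  have hHD : (H : Set G) ⊆ ↑(D ^ 2) := by
    intro x hx
    have h1 := hpw 10 x (hH10 hx)
    have h2 : (sabeD Y x : ℝ) < Y.card := by push_cast at h1; linarith
    have h3 : sabeD Y x < Y.card := by exact_mod_cast h2
    have h4 := Finset.card_sdiff_add_card_inter (x • Y) Y
    rw [Finset.card_smul_finset] at h4
    unfold sabeD at h3
    obtain ⟨y, hy⟩ : (x • Y ∩ Y).Nonempty := Finset.card_pos.1 (by omega)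
    rw [Finset.mem_inter, Finset.mem_smul_finset] at hy
    obtain ⟨⟨z, hz, rfl⟩, hy⟩ := hy
    rw [pow_two, Finset.mem_coe]
    refine Finset.mem_mul.2 ⟨_, hYD hy, z⁻¹, ?_, by simp⟩
    rw [← hDi]
    exact Finset.inv_mem_inv (hYD hz)
  refine ⟨H, hHcl.trans hXcl, ?_, hHD⟩
  have hfin : (H : Set G).Finite := (Finset.finite_toSet _).subset hHD
  set B := hfin.toFinset with hB
  have hBm : ∀ x, x ∈ B ↔ x ∈ H := fun x => by rw [hB, Set.Finite.mem_toFinset]; rfl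
  have hQB : Q ⊆ B := fun x hx => (hBm x).2 (hQH hx)
  have hBc : c2 * c1 * A.card ≤ B.card := by
    calc c2 * c1 * A.card = c2 * (c1 * A.card) := by ring
      _ ≤ c2 * X.card := by gcongr
      _ ≤ Q.card := hQc
      _ ≤ B.card := by exact_mod_cast Finset.card_le_card hQB
  obtain ⟨F, hFD, hFc, hF⟩ := Finset.ruzsa_covering_mul (A := D ^ m) (B := B)
    (K := ((k : ℝ) ^ 4) ^ (m + 2 + 1) * k / (c2 * c1)) ⟨1, (hBm 1).2 H.one_mem⟩ (by
      have h3 : D ^ m * B ⊆ D ^ (m + 2) := by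
        rw [pow_add]
        exact Finset.mul_subset_mul_left fun x hx => hHD ((hBm x).1 hx)
      calc ((D ^ m * B).card : ℝ) ≤ (D ^ (m + 2)).card := by exact_mod_cast Finset.card_le_card h3
        _ ≤ ((k : ℝ) ^ 4) ^ (m + 2 + 1) * k * A.card := hpow (m + 2)
        _ = ((k : ℝ) ^ 4) ^ (m + 2 + 1) * k / (c2 * c1) * (c2 * c1 * A.card) := by field_simp
        _ ≤ _ := by gcongr)
  refine ⟨F, ?_, ?_⟩
  · have := hFc.trans (Nat.le_ceil _)
    exact_mod_cast this
  · intro x hx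
    obtain ⟨f, hf, w, hw, rfl⟩ := Finset.mem_mul.1 (hF (Finset.mem_coe.1 hx))
    obtain ⟨a, ha, b, hb, rfl⟩ := Finset.mem_div.1 hw
    exact Set.mul_mem_mul hf (div_mem ((hBm a).1 ha) ((hBm b).1 hb))
end

section
/- For all positive integers k, m, and r there is a constant C = C(k, m, r) such that the following holds. If G is a group and A ⊆ G is a nonempty finite set with |AA⁻¹A| ≤ k|A|, the subgroup ⟨AA⁻¹⟩ has exponent r, and ⟨AA⁻¹⟩ = (AA⁻¹)ᵐ, then there is a normal subgroup H of ⟨AA⁻¹⟩ with [⟨AA⁻¹⟩ : H] ≤ C such that H ⊆ (AA⁻¹)². -/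
open Pointwise

open Pointwise

/-- ruzsa -/
lemma aux_growth {G : Type*} [Group G] [DecidableEq G] (A : Finset G) (k : ℕ)
    (hA : A.Nonempty) (h : (A * A⁻¹ * A).card ≤ k * A.card) (n : ℕ) :
    ((A * A⁻¹) ^ n * A).card ≤ k ^ (2 * n) * A.card := by
  have hpos : 0 < A.card := hA.card_pos
  have h' : (A⁻¹ * A * A⁻¹).card ≤ k * A.card := by
    have : (A⁻¹ * A * A⁻¹) = (A * A⁻¹ * A)⁻¹ := by simp [mul_inv_rev, mul_assoc]
    rw [this, Finset.card_inv]; exact h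
  induction n with
  | zero => simp
  | succ n ih =>
    have e1 := Finset.ruzsa_triangle_inequality_mulInv_mulInv_mulInv
      ((A * A⁻¹) ^ n) A⁻¹ (A * A⁻¹)
    have e2 := Finset.ruzsa_triangle_inequality_mulInv_mulInv_mulInv
      ((A * A⁻¹) ^ n * A) A (A⁻¹ * A)
    simp only [mul_inv_rev, inv_inv, Finset.card_inv] at e1 e2
    rw [← mul_assoc] at e1
    have q2 : (A * A⁻¹) ^ n * A * (A⁻¹ * A) = (A * A⁻¹) ^ (n+1) * A := by
      rw [pow_succ]; simp only [mul_assoc]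
    rw [q2] at e2
    set x := ((A * A⁻¹) ^ n * A * A⁻¹).card
    set y := ((A * A⁻¹) ^ (n+1) * A).card
    set z := ((A * A⁻¹) ^ n * A).card
    have f1 : x ≤ k * z := by
      apply Nat.le_of_mul_le_mul_right _ hpos
      calc _ ≤ _ := e1
        _ ≤ z * (k * A.card) := by gcongr
        _ = _ := by ring
    have f2 : y ≤ k * x := by
      apply Nat.le_of_mul_le_mul_right _ hpos
      calc _ ≤ _ := e2
        _ ≤ x * (k * A.card) := by gcongr
        _ = _ := by ring
    calc y ≤ k * (k * (k ^ (2*n) * A.card)) := f2.trans (by gcongr; exact f1.trans (by gcongr))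
      _ = _ := by ring

lemma aux_ring {R : Type*} [NormedRing R] [NormedAlgebra ℝ R] (x : R) (r : ℕ) (hr : 0 < r)
    (hx : x ^ r = 1) (B : ℝ) (hB : ∀ s : ℕ, ‖x ^ s‖ ≤ B) (hs : ‖x - 1‖ * B * r < 1) : x = 1 := by
  have hB0 : 0 ≤ B := (norm_nonneg _).trans (hB 0)
  by_contra hne
  have hy : 0 < ‖x - 1‖ := norm_pos_iff.2 (sub_ne_zero.2 hne)
  have h1 : ∀ t : ℕ, ‖∑ i ∈ Finset.range t, x ^ i‖ ≤ t * B := fun t => by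
    refine (norm_sum_le _ _).trans ?_
    refine (Finset.sum_le_sum fun i _ => hB i).trans ?_
    simp
  have h2 : ∀ t ∈ Finset.range r, ‖1 - x ^ t‖ ≤ ‖x - 1‖ * B * r := fun t ht => by
    rw [norm_sub_rev, ← mul_geom_sum]
    refine (norm_mul_le _ _).trans ?_
    have := h1 t
    have ht' : (t : ℝ) ≤ r := by exact_mod_cast (Finset.mem_range.1 ht).le
    calc ‖x - 1‖ * _ ≤ ‖x - 1‖ * (r * B) := by
          gcongr; exact this.trans (by gcongr)
      _ = _ := by ring
  have h3 : (r : ℝ) • (x - 1) = (x - 1) * ∑ t ∈ Finset.range r, (1 - x ^ t) := by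
    rw [Finset.sum_sub_distrib, mul_sub, mul_geom_sum, hx]
    simp [Nat.cast_smul_eq_nsmul]
    simp [mul_sub, sub_mul, Nat.cast_comm]
  have h4 : (r : ℝ) * ‖x - 1‖ ≤ ‖x - 1‖ * (r * (‖x - 1‖ * B * r)) := by
    calc (r : ℝ) * ‖x - 1‖ = ‖(r : ℝ) • (x - 1)‖ := by rw [norm_smul]; simp
      _ ≤ _ := by
        rw [h3]
        refine (norm_mul_le _ _).trans ?_
        gcongr
        refine (norm_sum_le _ _).trans ?_
        refine (Finset.sum_le_sum h2).trans ?_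
        simp
  have hr' : (0 : ℝ) < r := by exact_mod_cast hr
  have : 0 < (r : ℝ) * ‖x - 1‖ := by positivity
  nlinarith

section

attribute [local instance] Matrix.linftyOpNormedRing Matrix.linftyOpNormedAlgebra

lemma aux_norm {ι : Type*} [Fintype ι] [DecidableEq ι] (M : Matrix ι ι ℝ) (b : ℝ) (hb : 0 ≤ b)
    (h : ∀ i j, |M i j| ≤ b) : ‖M‖ ≤ Fintype.card ι * b := by
  rw [Matrix.linfty_opNorm_def]
  lift b to NNReal using hb
  rw [← NNReal.coe_natCast, ← NNReal.coe_mul, NNReal.coe_le_coe]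
  refine Finset.sup_le fun i _ => ?_
  refine (Finset.sum_le_sum (g := fun _ => b) fun j _ => ?_).trans ?_
  · rw [← NNReal.coe_le_coe]; simpa using h i j
  · simp

/-- packing -/
lemma aux_pack {Γ ι : Type*} [Group Γ] [Fintype ι] [DecidableEq ι] (c : Γ →* Matrix ι ι ℝ)
    (hc : ∀ g i j, |c g i j| ≤ 1) (r : ℕ) (hr : 0 < r) (hexp : ∀ g : Γ, g ^ r = 1)
    (D : ℕ) (hD : Fintype.card ι ≤ D) :
    c.ker.index ≤ (2 * (D ^ 3 * r + 1) + 1) ^ (D * D) := by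
  classical
  set d := Fintype.card ι with hd
  set L : ℕ := D ^ 3 * r + 1 with hL
  have hn : ∀ g, ‖c g‖ ≤ d := fun g => by
    simpa using aux_norm (c g) 1 zero_le_one (hc g)
  have key : ∀ g h : Γ, (∀ i j, ⌊c g i j * L⌋ = ⌊c h i j * L⌋) → g⁻¹ * h ∈ c.ker := by
    intro g h hgh
    rw [MonoidHom.mem_ker]
    have hL0 : (0 : ℝ) < L := by positivity
    have h1 : ‖c h - c g‖ ≤ d * (1 / L) := by
      apply aux_norm _ _ (by positivity)
      intro i j
      have := Int.abs_sub_lt_one_of_floor_eq_floor (hgh i j)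
      rw [← sub_mul, abs_mul, abs_of_pos hL0] at this
      rw [Matrix.sub_apply, abs_sub_comm, le_div_iff₀ hL0]
      exact this.le
    have h2 : c (g⁻¹ * h) - 1 = c g⁻¹ * (c h - c g) := by
      rw [mul_sub, ← map_mul, ← map_mul]; simp
    apply aux_ring _ r hr (by rw [← map_pow, hexp, map_one]) d
    · intro s; rw [← map_pow]; exact hn _
    · have h3 : ‖c (g⁻¹ * h) - 1‖ ≤ d * (d * (1 / L)) := by
        rw [h2]; refine (norm_mul_le _ _).trans ?_
        gcongr; exact hn _
      have hdD : (d : ℝ) ≤ D := by exact_mod_cast hD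
      calc ‖c (g⁻¹ * h) - 1‖ * d * r ≤ D * (D * (1 / L)) * D * r := by
            gcongr; exact h3.trans (by gcongr)
        _ = D ^ 3 * r / L := by ring
        _ < 1 := by rw [div_lt_one hL0, hL]; push_cast; linarith
  have hb : ∀ g i j, ⌊c g i j * L⌋ ∈ Finset.Icc (-(L : ℤ)) L := by
    intro g i j
    have := abs_le.1 (hc g i j)
    have hL0 : (0 : ℝ) < L := by positivity
    rw [Finset.mem_Icc, Int.le_floor]
    constructor
    · push_cast; nlinarith
    · rw [← Int.cast_le (R := ℝ)]
      refine (Int.floor_le _).trans ?_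
      push_cast; nlinarith
  let φ : Γ ⧸ c.ker → (ι × ι → Finset.Icc (-(L : ℤ)) L) := fun q p =>
    ⟨⌊c q.out p.1 p.2 * L⌋, hb _ _ _⟩
  have hφ : Function.Injective φ := by
    intro q q' hq
    rw [← q.out_eq, ← q'.out_eq]
    apply QuotientGroup.eq.2
    apply key
    intro i j
    have := congrFun hq (i, j)
    simpa [φ] using this
  have := Nat.card_le_card_of_injective φ hφ
  rw [Subgroup.index]
  refine this.trans ?_
  rw [Nat.card_eq_fintype_card, Fintype.card_fun, Fintype.card_prod, Fintype.card_coe, Int.card_Icc]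
  have : ((L : ℤ) + 1 - -(L : ℤ)).toNat = 2 * L + 1 := by omega
  rw [this]
  apply Nat.pow_le_pow_right (by omega)
  exact Nat.mul_le_mul hD hD

end

lemma aux_spec {n : Type*} [Fintype n] [DecidableEq n] (M : Matrix n n ℝ) (hM : M.PosSemidef) :
    ∃ (U : Matrix n n ℝ) (μ : n → ℝ), (∀ i, 0 ≤ μ i) ∧ U * U.transpose = 1 ∧ U.transpose * U = 1 ∧
      M = U.transpose * Matrix.diagonal μ * U := by
  refine ⟨(hM.1.eigenvectorUnitary : Matrix n n ℝ).transpose, hM.1.eigenvalues,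
    hM.eigenvalues_nonneg, ?_, ?_, ?_⟩
  · have := Unitary.coe_star_mul_self hM.1.eigenvectorUnitary
    simpa [Matrix.star_eq_conjTranspose] using this
  · have := Unitary.coe_mul_star_self hM.1.eigenvectorUnitary
    simpa [Matrix.star_eq_conjTranspose] using this
  · have := hM.1.spectral_theorem
    rw [Unitary.conjStarAlgAut_apply] at this
    simpa [Matrix.star_eq_conjTranspose, Function.comp_def] using this

/-- permutation matrix of left translation -/
def auxP {Γ : Type*} [Group Γ] [DecidableEq Γ] (g : Γ) : Matrix Γ Γ ℝ :=
  Matrix.of fun x y => if x = g * y then 1 else 0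

lemma auxP_mul_apply {Γ ι : Type*} [Group Γ] [DecidableEq Γ] [Fintype Γ] (g : Γ)
    (M : Matrix Γ ι ℝ) (x : Γ) (y : ι) : (auxP g * M) x y = M (g⁻¹ * x) y := by
  rw [Matrix.mul_apply, Finset.sum_eq_single (g⁻¹ * x)]
  · simp [auxP]
  · intro b _ hb
    have : x ≠ g * b := fun h => hb (by simp [h])
    simp [auxP, this]
  · simp

lemma auxP_apply_mul {Γ ι : Type*} [Group Γ] [DecidableEq Γ] [Fintype Γ] (g : Γ)
    (M : Matrix ι Γ ℝ) (x : ι) (y : Γ) : (M * auxP g) x y = M x (g * y) := by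
  rw [Matrix.mul_apply, Finset.sum_eq_single (g * y)]
  · simp [auxP]
  · intro b _ hb
    simp [auxP, hb]
  · simp

lemma auxP_mul {Γ : Type*} [Group Γ] [DecidableEq Γ] [Fintype Γ] (g h : Γ) :
    auxP (g * h) = auxP g * auxP h := by
  ext x y
  rw [auxP_mul_apply]
  simp [auxP, mul_assoc, inv_mul_eq_iff_eq_mul]

lemma auxP_one {Γ : Type*} [Group Γ] [DecidableEq Γ] : auxP (1 : Γ) = 1 := by
  ext x y
  simp [auxP, Matrix.one_apply]

lemma aux_main {Γ : Type*} [Group Γ] [DecidableEq Γ] [Fintype Γ] (r : ℕ) (hr : 0 < r)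
    (hexp : ∀ g : Γ, g ^ r = 1) (M : Matrix Γ Γ ℝ) (hM : M.PosSemidef)
    (hinv : ∀ g x y, M (g * x) (g * y) = M x y) (τ : ℝ) (hτ : 0 < τ) (D : ℕ)
    (htr : M.trace ≤ τ * D) :
    ∃ H : Subgroup Γ, H.Normal ∧ H.index ≤ (2 * (D ^ 3 * r + 1) + 1) ^ (D * D) ∧
      ∀ g ∈ H, (M * M) 1 1 - 2 * τ * M 1 1 ≤ (M * M) 1 g := by
  classical
  obtain ⟨U, μ, hμ, hU1, hU2, hMU⟩ := aux_spec M hM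
  let C : Γ → Matrix Γ Γ ℝ := fun g => U * auxP g * U.transpose
  have hCmul : ∀ g h, C (g * h) = C g * C h := fun g h => by
    calc C (g * h) = U * auxP g * 1 * auxP h * U.transpose := by
          simp only [C, auxP_mul, Matrix.mul_one, Matrix.mul_assoc]
      _ = _ := by rw [← hU2]; simp only [C, Matrix.mul_assoc]
  have hC1 : C 1 = 1 := by simp [C, auxP_one, hU1]
  have hcomm : ∀ g, M * auxP g = auxP g * M := fun g => by
    ext x y
    rw [auxP_mul_apply, auxP_apply_mul, ← hinv g (g⁻¹ * x) y]; simp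
  have hdiag : Matrix.diagonal μ = U * M * U.transpose := by
    rw [hMU]
    calc Matrix.diagonal μ = 1 * Matrix.diagonal μ * 1 := by simp
      _ = _ := by rw [← hU1]; simp only [Matrix.mul_assoc]
  have hdC : ∀ g, Matrix.diagonal μ * C g = C g * Matrix.diagonal μ := fun g => by
    calc Matrix.diagonal μ * C g = U * M * (U.transpose * U) * auxP g * U.transpose := by
          rw [hdiag]; simp only [C, Matrix.mul_assoc]
      _ = U * (M * auxP g) * U.transpose := by
          rw [hU2]; simp only [Matrix.mul_one, Matrix.mul_assoc]
      _ = U * auxP g * (U.transpose * U) * M * U.transpose := by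
          rw [hU2, hcomm]; simp only [Matrix.mul_one, Matrix.mul_assoc]
      _ = _ := by rw [hdiag]; simp only [C, Matrix.mul_assoc]
  have hent : ∀ g i j, μ i * C g i j = C g i j * μ j := fun g i j => by
    have := congrFun (congrFun (hdC g) i) j
    simpa [Matrix.diagonal_mul, Matrix.mul_diagonal] using this
  have hzero : ∀ g i j, ¬ τ ≤ μ i → τ ≤ μ j → C g i j = 0 := fun g i j hi hj => by
    have h := hent g i j
    have : C g i j * (μ j - μ i) = 0 := by linarith
    rcases mul_eq_zero.1 this with h | h
    · exact h
    · exact absurd (by linarith : τ ≤ μ i) hi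
  have hrow : ∀ i, ∑ y, U i y ^ 2 = 1 := fun i => by
    have := congrFun (congrFun hU1 i) i
    simpa [Matrix.mul_apply, pow_two] using this
  have hCb : ∀ g i j, |C g i j| ≤ 1 := fun g i j => by
    have e : C g i j = ∑ y, U i (g * y) * U j y := by
      simp only [C]
      rw [Matrix.mul_apply]
      simp [auxP_apply_mul]
    have e2 : ∑ y, U i (g * y) ^ 2 = 1 := by
      rw [← hrow i]
      exact Fintype.sum_equiv (Equiv.mulLeft g) _ _ fun x => rfl
    have e3 : ∑ y, |U i (g * y) * U j y| ≤ ∑ y, (U i (g * y) ^ 2 + U j y ^ 2) / 2 := by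
      apply Finset.sum_le_sum
      intro y _
      rw [abs_le]
      constructor <;> nlinarith [sq_nonneg (U i (g * y) + U j y), sq_nonneg (U i (g * y) - U j y)]
    rw [← Finset.sum_div, Finset.sum_add_distrib, e2, hrow] at e3
    rw [e]
    exact (Finset.abs_sum_le_sum_abs _ _).trans (by linarith)
  let I := {i : Γ // τ ≤ μ i}
  let c : Γ →* Matrix I I ℝ :=
    { toFun := fun g => (C g).submatrix Subtype.val Subtype.val
      map_one' := by
        rw [hC1]; exact Matrix.submatrix_one _ Subtype.val_injective
      map_mul' := by
        intro g h
        ext i j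
        rw [hCmul, Matrix.submatrix_apply, Matrix.mul_apply, Matrix.mul_apply]
        simp only [Matrix.submatrix_apply]
        have hs : ∑ x, C g i x * C h x j =
            ∑ x ∈ Finset.univ.filter (fun x => τ ≤ μ x), C g i x * C h x j := by
          symm
          apply Finset.sum_subset (Finset.subset_univ _)
          intro x _ hx
          rw [hzero h x j (by simpa using hx) j.2, mul_zero]
        rw [hs]
        exact Finset.sum_subtype _ (by simp) _ }
  have hI : Fintype.card I ≤ D := by
    have h1 : M.trace = ∑ i, μ i := by
      rw [hMU, Matrix.trace_mul_comm, ← Matrix.mul_assoc, hU1, Matrix.one_mul, Matrix.trace_diagonal]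
    have h2 : (Fintype.card I : ℝ) * τ ≤ ∑ i, μ i := by
      rw [Fintype.card_subtype, ← nsmul_eq_mul]
      refine (Finset.card_nsmul_le_sum _ μ τ (by simp)).trans ?_
      exact Finset.sum_le_sum_of_subset_of_nonneg (Finset.subset_univ _) fun i _ _ => hμ i
    have h3 : (Fintype.card I : ℝ) * τ ≤ D * τ := by linarith
    exact_mod_cast le_of_mul_le_mul_right h3 hτ
  refine ⟨c.ker, inferInstance, aux_pack c (fun g i j => hCb g i j) r hr hexp D hI, ?_⟩
  intro g hg
  rw [MonoidHom.mem_ker] at hg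
  have hfix : ∀ j, τ ≤ μ j → U j g = U j 1 := by
    intro j hj
    have e1 : U.transpose * C g = auxP g * U.transpose := by
      simp only [C]
      rw [← Matrix.mul_assoc, ← Matrix.mul_assoc, hU2, Matrix.one_mul]
    have e2 := congrFun (congrFun e1 g) j
    rw [auxP_mul_apply, Matrix.mul_apply, Finset.sum_eq_single j] at e2
    · have e3 : C g j j = 1 := by
        have := congrFun (congrFun hg ⟨j, hj⟩) ⟨j, hj⟩
        simpa [c] using this
      simpa [e3] using e2
    · intro i _ hij
      by_cases hi : τ ≤ μ i
      · have := congrFun (congrFun hg ⟨i, hi⟩) ⟨j, hj⟩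
        have e3 : C g i j = 0 := by
          simpa [c, Matrix.one_apply, hij] using this
        simp [e3]
      · simp [hzero g i j hi hj]
    · simp
  have hMx : ∀ x y, M x y = ∑ i, μ i * (U i x * U i y) := fun x y => by
    rw [hMU, Matrix.mul_apply]
    simp only [Matrix.mul_diagonal, Matrix.transpose_apply]
    exact Finset.sum_congr rfl fun i _ => by ring
  have hMM : M * M = U.transpose * Matrix.diagonal (fun i => μ i * μ i) * U := by
    calc M * M = U.transpose * Matrix.diagonal μ * (U * U.transpose) * Matrix.diagonal μ * U := by
          conv_lhs => rw [hMU]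
          simp only [Matrix.mul_assoc]
      _ = _ := by
          rw [hU1, Matrix.mul_one, Matrix.mul_assoc U.transpose, Matrix.diagonal_mul_diagonal]
  have hMMx : ∀ x y, (M * M) x y = ∑ i, μ i * μ i * (U i x * U i y) := fun x y => by
    rw [hMM, Matrix.mul_apply]
    simp only [Matrix.mul_diagonal, Matrix.transpose_apply]
    exact Finset.sum_congr rfl fun i _ => by ring
  have hgg : M g g = M 1 1 := by simpa using hinv g 1 1
  have hle : ∑ i, (μ i * μ i * (U i 1 * U i 1) - 3 / 2 * τ * (μ i * (U i 1 * U i 1))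
      - 1 / 2 * τ * (μ i * (U i g * U i g))) ≤ ∑ i, μ i * μ i * (U i 1 * U i g) := by
    apply Finset.sum_le_sum
    intro i _
    have p1 : 0 ≤ τ * (μ i * (U i 1 * U i 1)) :=
      mul_nonneg hτ.le (mul_nonneg (hμ i) (mul_self_nonneg _))
    have p2 : 0 ≤ τ * (μ i * (U i g * U i g)) :=
      mul_nonneg hτ.le (mul_nonneg (hμ i) (mul_self_nonneg _))
    by_cases hi : τ ≤ μ i
    · rw [hfix i hi] at *
      linarith
    · push Not at hi
      have p3 : 0 ≤ (τ - μ i) * μ i * (3 / 2 * (U i 1 * U i 1) + 1 / 2 * (U i g * U i g)) := by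
        apply mul_nonneg (mul_nonneg (by linarith) (hμ i))
        nlinarith [mul_self_nonneg (U i 1), mul_self_nonneg (U i g)]
      have p4 : 0 ≤ μ i * μ i * (U i 1 + U i g) ^ 2 := by
        have := hμ i
        positivity
      nlinarith
  rw [Finset.sum_sub_distrib, Finset.sum_sub_distrib, ← Finset.mul_sum, ← Finset.mul_sum,
    ← hMx, ← hMx, ← hMMx, ← hMMx, hgg] at hle
  linarith

lemma aux_group {Γ : Type*} [Group Γ] [DecidableEq Γ] [Fintype Γ] (r : ℕ) (hr : 0 < r)
    (hexp : ∀ g : Γ, g ^ r = 1) (A : Finset Γ) (hA : A.Nonempty) (K : ℕ) (hK : 0 < K)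
    (hcard : Fintype.card Γ ≤ K * A.card) :
    ∃ H : Subgroup Γ, H.Normal ∧
      H.index ≤ (2 * ((4 * K ^ 3) ^ 3 * r + 1) + 1) ^ ((4 * K ^ 3) * (4 * K ^ 3)) ∧
      ∀ g ∈ H, ∃ a ∈ A, ∃ b ∈ A, ∃ c ∈ A, ∃ d ∈ A, g = a * b⁻¹ * (c * d⁻¹) := by
  classical
  let B : Matrix Γ Γ ℝ := Matrix.of fun x z => if x⁻¹ * z ∈ A then 1 else 0
  let M : Matrix Γ Γ ℝ := B * B.transpose
  have hMx : ∀ x y, M x y = ∑ z, B x z * B y z := fun x y => by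
    simp [M, Matrix.mul_apply]
  have hBinv : ∀ g x z, B (g * x) (g * z) = B x z := fun g x z => by
    simp [B, mul_assoc]
  have hPSD : M.PosSemidef := by
    have := Matrix.posSemidef_self_mul_conjTranspose B
    simpa [M] using this
  have hinv : ∀ g x y, M (g * x) (g * y) = M x y := fun g x y => by
    rw [hMx, hMx]
    exact (Fintype.sum_equiv (Equiv.mulLeft g) _ _ fun z => by simp [hBinv]).symm
  have hM11 : M 1 1 = A.card := by
    rw [hMx]; simp [B]
  have hdiagM : ∀ x, M x x = A.card := fun x => by
    rw [← hM11]; simpa using hinv x 1 1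
  set N := Fintype.card Γ with hN
  have hNpos : (0 : ℝ) < N := by exact_mod_cast Fintype.card_pos
  have hApos : (0 : ℝ) < A.card := by exact_mod_cast hA.card_pos
  have hKpos : (0 : ℝ) < K := by exact_mod_cast hK
  have hc : (N : ℝ) ≤ K * A.card := by exact_mod_cast hcard
  have hAN : (A.card : ℝ) ≤ N := by exact_mod_cast Finset.card_le_univ A
  have hcol : ∀ z, ∑ y, B y z = A.card := fun z => by
    have : ∑ y, B y z = ∑ y, if y ∈ A then (1 : ℝ) else 0 := by
      refine Fintype.sum_equiv ((Equiv.inv Γ).trans (Equiv.mulRight z)) _ _ fun y => ?_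
      simp [B]
    rw [this]; simp
  have hrowM : ∑ y, M 1 y = (A.card : ℝ) ^ 2 := by
    simp only [hMx]
    rw [Finset.sum_comm]
    simp only [← Finset.mul_sum, hcol]
    rw [← Finset.sum_mul]
    simp [B, pow_two]
  have hsymm : ∀ x y, M x y = M y x := fun x y => by
    rw [hMx, hMx]; exact Finset.sum_congr rfl fun z _ => mul_comm _ _
  have hMM : ((A.card : ℝ) ^ 2) ^ 2 ≤ N * (M * M) 1 1 := by
    have h := sq_sum_le_card_mul_sum_sq (s := Finset.univ) (f := fun y => M 1 y)
    rw [hrowM] at h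
    rw [Matrix.mul_apply]
    refine h.trans (le_of_eq ?_)
    rw [Finset.card_univ]
    congr 1
    exact Finset.sum_congr rfl fun y _ => by rw [hsymm y 1, pow_two]
  set τ : ℝ := N ^ 2 / (4 * K ^ 3) with hτ
  obtain ⟨H, h1, h2, h3⟩ := aux_main r hr hexp M hPSD hinv τ (by positivity) (4 * K ^ 3) (by
    rw [Matrix.trace]
    simp only [Matrix.diag_apply, hdiagM]
    rw [hτ]; push_cast
    rw [div_mul_cancel₀ _ (by positivity)]
    simp only [Finset.sum_const, Finset.card_univ, nsmul_eq_mul]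
    rw [← hN, pow_two]; gcongr)
  refine ⟨H, h1, h2, fun g hg => ?_⟩
  have h4 := h3 g hg
  rw [hM11] at h4
  have hpos : 0 < (M * M) 1 g := by
    refine lt_of_lt_of_le ?_ h4
    rw [sub_pos]
    apply lt_of_mul_lt_mul_left _ hNpos.le
    refine lt_of_lt_of_le ?_ hMM
    have e1 : (N : ℝ) ^ 3 ≤ (K * A.card) ^ 3 := by gcongr
    calc (N : ℝ) * (2 * τ * A.card) = N ^ 3 / (2 * K ^ 3) * A.card := by
          rw [hτ]; field_simp; ring
      _ ≤ (K * A.card) ^ 3 / (2 * K ^ 3) * A.card := by gcongr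
      _ = (A.card : ℝ) ^ 4 / 2 := by field_simp
      _ < _ := by
        have : (0 : ℝ) < (A.card : ℝ) ^ 4 := by positivity
        nlinarith
  rw [Matrix.mul_apply] at hpos
  obtain ⟨y, -, hy⟩ := Finset.exists_ne_zero_of_sum_ne_zero hpos.ne'
  have hne : ∀ x y, M x y ≠ 0 → ∃ a ∈ A, ∃ b ∈ A, x⁻¹ * y = a * b⁻¹ := by
    intro x y h
    rw [hMx] at h
    obtain ⟨z, -, hz⟩ := Finset.exists_ne_zero_of_sum_ne_zero h
    refine ⟨x⁻¹ * z, ?_, y⁻¹ * z, ?_, by group⟩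
    · by_contra hn; exact hz (by simp [B, hn])
    · by_contra hn; exact hz (by simp [B, hn])
  obtain ⟨a, ha, b, hb, e1⟩ := hne _ _ (left_ne_zero_of_mul hy)
  obtain ⟨c, hc, d, hd, e2⟩ := hne _ _ (right_ne_zero_of_mul hy)
  refine ⟨a, ha, b, hb, c, hc, d, hd, ?_⟩
  rw [← e1, ← e2]; group

/-- For all positive integers `k`, `m`, `r` there is `C` such that: if `G` is a group and
`A ⊆ G` is nonempty finite with `|AA⁻¹A| ≤ k|A|`, `⟨AA⁻¹⟩` has exponent `r`, and
`⟨AA⁻¹⟩ = (AA⁻¹)ᵐ`, then there is a normal subgroup `H` of `⟨AA⁻¹⟩` of index at most `C`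
with `H ⊆ (AA⁻¹)²`. -/
theorem small_alternation_bounded_exponent_normal (k m r : ℕ) (hk : 0 < k) (hm : 0 < m)
    (hr : 0 < r) :
    ∃ C : ℕ, ∀ (G : Type) [Group G] [DecidableEq G],
      ∀ A : Finset G, A.Nonempty →
      (A * A⁻¹ * A).card ≤ k * A.card →
      (∀ x ∈ Subgroup.closure ((A * A⁻¹ : Finset G) : Set G), x ^ r = 1) →
      ((Subgroup.closure ((A * A⁻¹ : Finset G) : Set G) : Set G)
        = (((A * A⁻¹) ^ m : Finset G) : Set G)) →
      ∃ H : Subgroup ↥(Subgroup.closure ((A * A⁻¹ : Finset G) : Set G)),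
        H.Normal ∧ H.index ≤ C ∧
        (∀ x : ↥(Subgroup.closure ((A * A⁻¹ : Finset G) : Set G)),
          x ∈ H → (x : G) ∈ ((A * A⁻¹) ^ 2 : Finset G)) := by
  have hK : 0 < k ^ (2 * m) := by positivity
  refine ⟨(2 * ((4 * (k ^ (2 * m)) ^ 3) ^ 3 * r + 1) + 1) ^
    ((4 * (k ^ (2 * m)) ^ 3) * (4 * (k ^ (2 * m)) ^ 3)), ?_⟩
  intro G _ _ A hA hcard hexp hgen
  obtain ⟨a₀, ha₀⟩ := hA
  have hA : A.Nonempty := ⟨a₀, ha₀⟩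
  set Γ := Subgroup.closure ((A * A⁻¹ : Finset G) : Set G) with hΓ
  have hmem : ∀ x, x ∈ Γ ↔ x ∈ (A * A⁻¹) ^ m := fun x => by
    have := Set.ext_iff.1 hgen x
    simpa only [SetLike.mem_coe, Finset.mem_coe] using this
  haveI : Fintype Γ := Fintype.subtype ((A * A⁻¹) ^ m) fun x => (hmem x).symm
  have hN : Fintype.card Γ ≤ k ^ (2 * m) * A.card := by
    have e : Fintype.card Γ = ((A * A⁻¹) ^ m).card :=
      Fintype.card_of_subtype _ fun x => (hmem x).symm
    rw [e]
    exact (Finset.card_le_card_mul_right hA).trans (aux_growth A k hA hcard m)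
  have hin : ∀ a ∈ A, a * a₀⁻¹ ∈ Γ := fun a ha =>
    Subgroup.subset_closure (by
      rw [Finset.mem_coe]
      exact Finset.mul_mem_mul ha (Finset.inv_mem_inv ha₀))
  let A' : Finset Γ := Finset.univ.filter fun x => (x : G) * a₀ ∈ A
  have hA' : ∀ x, x ∈ A' ↔ (x : G) * a₀ ∈ A := fun x => by simp [A']
  have hc' : A.card ≤ A'.card := by
    apply Finset.card_le_card_of_surjOn (fun x : Γ => (x : G) * a₀)
    intro a ha
    exact ⟨⟨a * a₀⁻¹, hin a ha⟩, by simpa [A'] using ha, by simp⟩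
  obtain ⟨H, h1, h2, h3⟩ := aux_group r hr (fun g : Γ => Subtype.ext (by
      simpa using hexp g g.2)) A'
    (Finset.card_pos.1 (lt_of_lt_of_le hA.card_pos hc')) (k ^ (2 * m)) hK
    (hN.trans (by gcongr))
  refine ⟨H, h1, h2, fun x hx => ?_⟩
  obtain ⟨a, ha, b, hb, c, hc, d, hd, e⟩ := h3 x hx
  rw [hA'] at ha hb hc hd
  have : (x : G) = ((a : G) * a₀) * ((b : G) * a₀)⁻¹ * (((c : G) * a₀) * ((d : G) * a₀)⁻¹) := by
    rw [e]; push_cast; group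
  rw [this, pow_two]
  exact Finset.mul_mem_mul (Finset.mul_mem_mul ha (Finset.inv_mem_inv hb))
    (Finset.mul_mem_mul hc (Finset.inv_mem_inv hd))
end
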